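/- arXiv:2512.00720 — 2 statements merged into one kernel-verified Lean document; each statement's English description precedes it below -/
import Mathlib

section
/- For any all-active configuration η on a finite set V ⊂ ℤ^d containing the origin, the expected number of chances in the strong stabilization of η on V with respect to the origin satisfies E[Ch(η, V)] ≤ G(ℤ^d, P), the Green's function of the walk. -/
/-!
Common framework for the activated random walk (ARW) model on `ℤ^d`,
via the site-wise (Diaconis–Fulton) representation.
-/

open MeasureTheory ENNReal Filter

namespace ARW

noncomputable section
open scoped Classical

/-- A site of the lattice `ℤ^d`. -/
abbrev Site (d : ℕ) := Fin d → ℤ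

/-- An instruction: `none` is a sleep instruction, `some z` is a jump instruction
with displacement `z`. -/
abbrev Instr (d : ℕ) := Option (Site d)

instance (d : ℕ) : MeasurableSpace (Instr d) := ⊤

/-- The array of instruction stacks: `I (x, k)` is the `k`-th instruction at site `x`. -/
abbrev Stacks (d : ℕ) := Site d × ℕ → Instr d

/-- The state of a site: `active n` means `n` active particles (and no sleeping one),
`sleeping` means a single sleeping particle. -/
inductive SiteState : Type
  | active : ℕ → SiteState
  | sleeping : SiteState
  deriving DecidableEq

/-- A particle configuration. -/
abbrev Config (d : ℕ) := Site d → SiteState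

/-- Number of active particles at a site state. -/
def numActive : SiteState → ℕ
  | .active n => n
  | .sleeping => 0

/-- Adding one (active) particle to a site: a sleeping particle is reactivated. -/
def addParticle : SiteState → SiteState
  | .active n => .active (n + 1)
  | .sleeping => .active 2

/-- A state of the system: a configuration together with an odometer
(number of instructions already used at each site). -/
abbrev State (d : ℕ) := Config d × (Site d → ℕ)

/-- Initial state on `V` obtained from an all-active particle count `η` (particles
outside `V` are discarded), with odometer `0`. -/
def initState (d : ℕ) (V : Finset (Site d)) (η : Site d → ℕ) : State d :=
  (fun x => .active (if x ∈ V then η x else 0), fun _ => 0)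

/-- Toppling the site `x` (inside `V`, particles jumping out of `V` are killed):
the next unused instruction at `x` is executed and the odometer at `x` increases by one.
A sleep instruction puts the particle at `x` to sleep if it is alone (otherwise it has
no effect), and a jump instruction moves one particle from `x` to `x + z`
(reactivating a sleeping particle there), killing it if `x + z ∉ V`. -/
def topple {d : ℕ} (V : Finset (Site d)) (I : Stacks d) (x : Site d) (s : State d) :
    State d :=
  let σ := s.1
  let m := s.2
  let σ' : Config d :=
    match I (x, m x) with
    | none => if numActive (σ x) = 1 then Function.update σ x .sleeping else σ
    | some z =>
        let σ₁ := Function.update σ x (SiteState.active (numActive (σ x) - 1))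
        if x + z ∈ V then Function.update σ₁ (x + z) (addParticle (σ₁ (x + z))) else σ₁
  (σ', Function.update m x (m x + 1))

/-- Running a sequence of topplings. -/
def run {d : ℕ} (V : Finset (Site d)) (I : Stacks d) : State d → List (Site d) → State d
  | s, [] => s
  | s, x :: l => run V I (topple V I x s) l

/-- Legality of a toppling sequence: every toppled site lies in `V` and holds at least one
active particle when toppled. -/
def Legal {d : ℕ} (V : Finset (Site d)) (I : Stacks d) : State d → List (Site d) → Prop
  | _, [] => True
  | s, x :: l => x ∈ V ∧ 1 ≤ numActive (s.1 x) ∧ Legal V I (topple V I x s) l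

/-- A configuration is stable in `V` if no site of `V` holds an active particle. -/
def Stable {d : ℕ} (V : Finset (Site d)) (σ : Config d) : Prop :=
  ∀ x ∈ V, numActive (σ x) = 0

/-- The stabilization of `η` in `V` terminates. -/
def StabCompletes {d : ℕ} (V : Finset (Site d)) (I : Stacks d) (η : Site d → ℕ) : Prop :=
  ∃ l, Legal V I (initState d V η) l ∧ Stable V (run V I (initState d V η) l).1

/-- The stable configuration `Stab_V η` (well defined, independently of the chosen legal
toppling sequence, by the abelian property), when stabilization terminates. -/
def stabConfig {d : ℕ} (V : Finset (Site d)) (I : Stacks d) (η : Site d → ℕ) : Config d :=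
  if h : StabCompletes V I η then (run V I (initState d V η) h.choose).1
  else fun _ => .active 0

/-- The event `0 ∈ Stab_V η`: stabilization of `η` in `V` ends with a sleeping particle
at the origin. -/
def SleepAt0 {d : ℕ} (V : Finset (Site d)) (I : Stacks d) (η : Site d → ℕ) : Prop :=
  StabCompletes V I η ∧ stabConfig V I η 0 = .sleeping

/-- The event `0 ∉ Stab_V η`: stabilization of `η` in `V` ends with the origin empty. -/
def EmptyAt0 {d : ℕ} (V : Finset (Site d)) (I : Stacks d) (η : Site d → ℕ) : Prop :=
  StabCompletes V I η ∧ stabConfig V I η 0 ≠ .sleeping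

/-- The limiting odometer of `η` at the origin: the supremum, over finite volumes `V` and
legal toppling sequences in `V`, of the number of topplings performed at the origin. -/
def odom0 {d : ℕ} (I : Stacks d) (η : Site d → ℕ) : ℕ∞ :=
  ⨆ (V : Finset (Site d)) (l : List (Site d)) (_ : Legal V I (initState d V η) l),
    (l.count 0 : ℕ∞)

/-! ### The random instructions -/

/-- The normalized sleep rate `λ_s = λ/(1+λ)`. -/
def lamS (lam : ℝ) : ℝ := lam / (1 + lam)

/-- The normalized jump rate `λ_J = 1/(1+λ)`. -/
def lamJ (lam : ℝ) : ℝ := 1 / (1 + lam)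

/-- The distribution of a single instruction: sleep with probability `λ_s`, jump by `z`
with probability `λ_J · step z`. -/
def instrWeight {d : ℕ} (step : Site d → ℝ) (lam : ℝ) : Instr d → ℝ≥0∞
  | none => ENNReal.ofReal (lamS lam)
  | some z => ENNReal.ofReal (lamJ lam) * ENNReal.ofReal (step z)

/-- `μ` is the law of the i.i.d. instruction stacks: a probability measure whose
finite-dimensional cylinder probabilities are the products of the `instrWeight`s. -/
def IsStackLaw (d : ℕ) (step : Site d → ℝ) (lam : ℝ) (μ : Measure (Stacks d)) : Prop :=
  IsProbabilityMeasure μ ∧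
    ∀ (F : Finset (Site d × ℕ)) (g : Site d × ℕ → Instr d),
      μ {I | ∀ i ∈ F, I i = g i} = ∏ i ∈ F, instrWeight step lam (g i)

/-- The law of the i.i.d. instruction stacks (uniquely determined by its cylinder
probabilities; it exists whenever `step` is a probability distribution and `λ > 0`). -/
def stackLaw (d : ℕ) (step : Site d → ℝ) (lam : ℝ) : Measure (Stacks d) :=
  if h : ∃ μ, IsStackLaw d step lam μ then h.choose else 0

/-! ### Fixation and the critical density -/

/-- Translation of a particle count by `z`. -/
def shift {d : ℕ} (z : Site d) (η : Site d → ℕ) : Site d → ℕ := fun x => η (x + z)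

/-- A translation-ergodic distribution of particles: invariant under all translations,
and every translation-invariant event is trivial. -/
def IsTransErgodic {d : ℕ} (ν : Measure (Site d → ℕ)) : Prop :=
  (∀ z, Measure.map (shift z) ν = ν) ∧
    ∀ s : Set (Site d → ℕ), MeasurableSet s → (∀ z, shift z ⁻¹' s = s) → ν s = 0 ∨ ν s = 1

/-- Almost sure fixation of the initial distribution `ν`: for `ν`-almost every initial
configuration and almost every instructions, the limiting odometer at the origin is
finite (equivalently, by Amir–Gurel-Gurevich, every particle eventually sleeps forever). -/
def Fixates (d : ℕ) (step : Site d → ℝ) (lam : ℝ) (ν : Measure (Site d → ℕ)) : Prop :=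
  ∀ᵐ η ∂ν, ∀ᵐ I ∂(stackLaw d step lam), odom0 I η ≠ ⊤

/-- The critical density `ρ_c(ℤ^d, P, λ)`: the supremum of the densities `ρ` such that
every translation-ergodic probability distribution of active particles with mean `ρ`
particles per site fixates almost surely. -/
def critDensity (d : ℕ) (step : Site d → ℝ) (lam : ℝ) : ℝ :=
  sSup {ρ : ℝ | 0 ≤ ρ ∧
    ∀ ν : Measure (Site d → ℕ), IsProbabilityMeasure ν → IsTransErgodic ν →
      (∫⁻ η, (η 0 : ℝ≥0∞) ∂ν) = ENNReal.ofReal ρ → Fixates d step lam ν}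

/-! ### Random walk quantities -/

/-- Simple symmetric nearest-neighbour step distribution on `ℤ^d`. -/
def ssrwStep (d : ℕ) : Site d → ℝ :=
  fun z => if (∑ i, (z i).natAbs) = 1 then (1 : ℝ) / (2 * d) else 0

/-- `psum w k` : position after the first `k` steps with increments `w`. -/
def psum {d n : ℕ} (w : Fin n → Site d) (k : ℕ) : Site d :=
  ∑ i ∈ Finset.univ.filter (fun i : Fin n => (i : ℕ) < k), w i

/-- Probability of a given sequence of increments. -/
def pathProb {d n : ℕ} (step : Site d → ℝ) (w : Fin n → Site d) : ℝ := ∏ i, step (w i)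

/-- `P(S_n = 0)` for the discrete-time walk started at `0`. -/
def probAt0 {d : ℕ} (step : Site d → ℝ) (n : ℕ) : ℝ :=
  ∑' w : Fin n → Site d, if psum w n = 0 then pathProb step w else 0

/-- The Green's function `G = Σ_{n ≥ 0} P(S_n = 0)` of the walk, valued in `[0, ∞]`.
The walk is transient iff `greenE step < ∞`. -/
def greenE {d : ℕ} (step : Site d → ℝ) : ℝ≥0∞ :=
  ∑' n : ℕ, ENNReal.ofReal (probAt0 step n)

/-- Probability that the walk returns to `0` for the first time at time `n`, having
stayed inside `A` at all intermediate times. -/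
def returnIn {d : ℕ} (step : Site d → ℝ) (A : Set (Site d)) (n : ℕ) : ℝ :=
  ∑' w : Fin n → Site d,
    if (∀ k, 0 < k → k < n → psum w k ≠ 0 ∧ psum w k ∈ A) ∧ psum w n = 0
    then pathProb step w else 0

/-- `P(τ = n)` where `τ` is the first return time to the origin. -/
def firstReturn {d : ℕ} (step : Site d → ℝ) (n : ℕ) : ℝ := returnIn step Set.univ n

/-- The probability that the walk started at `0` exits `A` strictly before returning
to `0`. -/
def escProb {d : ℕ} (step : Site d → ℝ) (A : Set (Site d)) : ℝ :=
  ∑' n : ℕ, ∑' w : Fin (n + 1) → Site d,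
    if (∀ k, 0 < k → k ≤ n → psum w k ≠ 0 ∧ psum w k ∈ A) ∧ psum w (n + 1) ∉ A
    then pathProb step w else 0

/-- `q(ℤ^d, P, λ)`: the probability that a single particle started at the origin falls
asleep at the origin, i.e. that the walk is at `0` after `N` steps where
`P(N = n) = λ_s λ_J^n`. -/
def qProb {d : ℕ} (step : Site d → ℝ) (lam : ℝ) : ℝ :=
  ∑' n : ℕ, lamS lam * lamJ lam ^ n * probAt0 step n

/-- The ball `B_r = {x : ‖x‖₁ ≤ r}`. -/
def ball (d : ℕ) (r : ℝ) : Set (Site d) := {x | ((∑ i, (x i).natAbs : ℕ) : ℝ) ≤ r}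

/-- `η` fills `A`: at least one particle at each site of `A`. -/
def Fills {d : ℕ} (η : Site d → ℕ) (A : Set (Site d)) : Prop := ∀ x ∈ A, 1 ≤ η x

/-! ### Weak stabilization, strong stabilization and the number of chances -/

/-- Legality of a weak toppling sequence (with respect to the origin): off the origin as
usual, while the origin may only be toppled if it holds at least two active particles. -/
def WLegal {d : ℕ} (V : Finset (Site d)) (I : Stacks d) : State d → List (Site d) → Prop
  | _, [] => True
  | s, x :: l => x ∈ V ∧ (if x = 0 then 2 else 1) ≤ numActive (s.1 x) ∧
      WLegal V I (topple V I x s) l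

/-- Weak stability in `V` with respect to the origin. -/
def WStable {d : ℕ} (V : Finset (Site d)) (σ : Config d) : Prop :=
  numActive (σ 0) ≤ 1 ∧ ∀ x ∈ V, x ≠ 0 → numActive (σ x) = 0

/-- The weak stabilization of a state (well defined by the abelian property whenever it
terminates). -/
def weakStab {d : ℕ} (V : Finset (Site d)) (I : Stacks d) (s : State d) : State d :=
  if h : ∃ l, WLegal V I s l ∧ WStable V (run V I s l).1 then run V I s h.choose else s

/-- The jump-out step: the particle at the origin is acceptably toppled (consuming
instructions at the origin, ignoring the sleep instructions) until it jumps out. -/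
def jumpOut {d : ℕ} (V : Finset (Site d)) (I : Stacks d) (s : State d) : State d :=
  if h : ∃ k, (I (0, s.2 0 + k)).isSome then
    let k := Nat.find h
    let z := (I (0, s.2 0 + k)).get (Nat.find_spec h)
    let σ₁ := Function.update s.1 0 (SiteState.active (numActive (s.1 0) - 1))
    let σ' := if (0 : Site d) + z ∈ V then
        Function.update σ₁ ((0 : Site d) + z) (addParticle (σ₁ ((0 : Site d) + z)))
      else σ₁
    (σ', Function.update s.2 0 (s.2 0 + k + 1))
  else s

/-- The states of the strong stabilization of `η` on `V` with respect to the origin via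
successive weak stabilizations: `procState j` is the state after the `(j+1)`-st weak
stabilization; as long as the origin holds an active particle, it is jumped out and the
configuration is weakly stabilized again. -/
def procState {d : ℕ} (V : Finset (Site d)) (I : Stacks d) (η : Site d → ℕ) :
    ℕ → State d
  | 0 => weakStab V I (initState d V η)
  | j + 1 =>
      let s := procState V I η j
      if 1 ≤ numActive (s.1 0) then weakStab V I (jumpOut V I s) else s

/-- The number of chances `Ch(η, V)`: the number of completed iterations of the strong
stabilization procedure, i.e. the first `j` such that the origin is empty after the
`(j+1)`-st weak stabilization. -/
def chances {d : ℕ} (V : Finset (Site d)) (I : Stacks d) (η : Site d → ℕ) : ℕ∞ :=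
  if h : ∃ j, numActive ((procState V I η j).1 0) = 0 then (Nat.find h : ℕ∞) else ⊤

/-- The `j`-th weakly stable configuration `η^W_j` (for `1 ≤ j`). -/
def weakConfig {d : ℕ} (V : Finset (Site d)) (I : Stacks d) (η : Site d → ℕ) (j : ℕ) :
    Config d :=
  (procState V I η (j - 1)).1

/-- The `j`-th sleep trial `b_j` (for `1 ≤ j`): whether the first instruction used in the
`j`-th jump-out step is a sleep instruction. -/
def sleepTrial {d : ℕ} (V : Finset (Site d)) (I : Stacks d) (η : Site d → ℕ) (j : ℕ) :
    Prop :=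
  I (0, (procState V I η (j - 1)).2 0) = none

/-- `a^n` for `n ∈ ℕ∞`, with `a^∞ = 0` (appropriate for `a < 1`). -/
def enpow (a : ℝ≥0∞) : ℕ∞ → ℝ≥0∞
  | ⊤ => 0
  | (n : ℕ) => a ^ n

end
end ARW

open MeasureTheory ENNReal Filter Topology ARW

namespace ARW

noncomputable section
open scoped Classical

variable {d : ℕ}

/-- Net change of the particle count at `w` when instruction `i` is executed at `y`. -/
def dlt (y : Site d) (i : Instr d) (w : Site d) : ℤ :=
  match i with
  | none => 0
  | some z => (if y + z = w then 1 else 0) - (if y = w then 1 else 0)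

/-- Particle count at `w` after executing the odometer `m` from the counts `ζ`. -/
def cnt (V : Finset (Site d)) (I : Stacks d) (ζ : Site d → ℤ) (m : Site d → ℕ) (w : Site d) : ℤ :=
  ζ w + ∑ y ∈ V, ∑ k ∈ Finset.range (m y), dlt y (I (y, k)) w

/-- Number of jump instructions among the first `n` instructions at the origin. -/
def J (I : Stacks d) (n : ℕ) : ℕ :=
  ∑ k ∈ Finset.range n, (if (I (0, k)).isSome then 1 else 0)

/-- The last executed instruction at `x` is a sleep instruction. -/
def LS (I : Stacks d) (m : Site d → ℕ) (x : Site d) : Prop :=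
  ∃ k, m x = k + 1 ∧ I (x, k) = none

/-- `m` is a strongly stabilizing odometer. -/
def Stab (V : Finset (Site d)) (I : Stacks d) (ζ : Site d → ℤ) (m : Site d → ℕ) : Prop :=
  ∀ x ∈ V, cnt V I ζ m x ≤ 0 ∨ (x ≠ 0 ∧ cnt V I ζ m x = 1 ∧ LS I m x)

/-- Invariant relating configuration and odometer. -/
def Inv (V : Finset (Site d)) (I : Stacks d) (ζ : Site d → ℤ) (s : State d) : Prop :=
  ∀ x ∈ V, (∃ n : ℕ, s.1 x = .active n ∧ cnt V I ζ s.2 x = n ∧ (x ≠ 0 → n ≤ 1 → ¬ LS I s.2 x)) ∨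
    (s.1 x = .sleeping ∧ x ≠ 0 ∧ cnt V I ζ s.2 x = 1 ∧ LS I s.2 x)

lemma J_mono (I : Stacks d) {a b : ℕ} (h : a ≤ b) : J I a ≤ J I b :=
  Finset.sum_le_sum_of_subset (Finset.range_mono h)

lemma J_succ (I : Stacks d) (a : ℕ) :
    J I (a + 1) = J I a + (if (I (0, a)).isSome then 1 else 0) := by
  unfold J; rw [Finset.sum_range_succ]

lemma cnt_succ {V : Finset (Site d)} (I : Stacks d) (ζ : Site d → ℤ) (m : Site d → ℕ)
    {x : Site d} (hx : x ∈ V) (w : Site d) :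
    cnt V I ζ (Function.update m x (m x + 1)) w = cnt V I ζ m w + dlt x (I (x, m x)) w := by
  unfold cnt
  have : ∀ y ∈ V, ∑ k ∈ Finset.range (Function.update m x (m x + 1) y), dlt y (I (y, k)) w
      = ∑ k ∈ Finset.range (m y), dlt y (I (y, k)) w
        + (if y = x then dlt x (I (x, m x)) w else 0) := by
    intro y _
    by_cases h : y = x
    · subst h; simp [Finset.sum_range_succ]
    · simp [h]
  rw [Finset.sum_congr rfl this, Finset.sum_add_distrib]
  simp [hx, add_assoc]

lemma cnt_mono {V : Finset (Site d)} (I : Stacks d) (ζ : Site d → ℤ) {m m' : Site d → ℕ}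
    (h : ∀ x ∈ V, m x ≤ m' x) {w : Site d} (hw : m w = m' w) :
    cnt V I ζ m w ≤ cnt V I ζ m' w := by
  unfold cnt
  refine add_le_add le_rfl (Finset.sum_le_sum fun y hy => ?_)
  by_cases hyw : y = w
  · subst hyw; rw [hw]
  · apply Finset.sum_le_sum_of_subset_of_nonneg (Finset.range_mono (h y hy))
    intro k _ _
    unfold dlt
    split <;> simp [hyw]
    split_ifs <;> simp

/-- Least action principle, one step. -/
lemma lt_of_active {V : Finset (Site d)} {I : Stacks d} {ζ : Site d → ℤ} {s : State d}
    {m : Site d → ℕ} (hs : Inv V I ζ s) (hm : Stab V I ζ m) (hle : ∀ x ∈ V, s.2 x ≤ m x)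
    {x : Site d} (hx : x ∈ V) (ha : 1 ≤ numActive (s.1 x)) : s.2 x < m x := by
  refine lt_of_le_of_ne (hle x hx) fun heq => ?_
  have hc := cnt_mono I ζ hle heq
  rcases hs x hx with ⟨n, hn, hcn, hL⟩ | ⟨hn, _⟩
  · rw [hn] at ha
    simp only [numActive] at ha
    rcases hm x hx with h | ⟨h0, h, k, hk, hk'⟩
    · omega
    · exact hL h0 (by omega) ⟨k, by omega, hk'⟩
  · rw [hn] at ha; simp [numActive] at ha

lemma Inv_topple {V : Finset (Site d)} {I : Stacks d} {ζ : Site d → ℤ} {s : State d}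
    (hs : Inv V I ζ s) {x : Site d} (hx : x ∈ V) (ha : 1 ≤ numActive (s.1 x))
    (ha' : x = 0 → 2 ≤ numActive (s.1 x) ∨ I (x, s.2 x) ≠ none) :
    Inv V I ζ (topple V I x s) := by
  obtain ⟨σ, m⟩ := s
  simp only at ha ha'
  rcases hs x hx with ⟨n, hn, hcn, hL⟩ | ⟨hn, _⟩
  swap
  · simp only at hn; rw [hn] at ha; simp [numActive] at ha
  simp only at hn hcn hL
  rw [hn] at ha ha'
  simp only [numActive] at ha ha'
  have hLS : ∀ w, w ≠ x → (LS I (Function.update m x (m x + 1)) w ↔ LS I m w) := by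
    intro w hw; simp [LS, Function.update_of_ne hw]
  have hLSx : LS I (Function.update m x (m x + 1)) x ↔ I (x, m x) = none := by
    simp only [LS, Function.update_self]
    constructor
    · rintro ⟨k, hk, hk'⟩
      obtain rfl : k = m x := by omega
      exact hk'
    · intro h; exact ⟨_, rfl, h⟩
  intro w hw
  have hold := hs w hw
  simp only at hold
  unfold topple
  simp only [hn, numActive]
  rw [cnt_succ I ζ m hx w]
  cases hI : I (x, m x) with
  | none =>
    simp only [dlt, add_zero]
    by_cases hwx : w = x
    · subst hwx
      by_cases h1 : n = 1
      · right
        refine ⟨by simp [h1], ?_, by omega, hLSx.2 hI⟩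
        intro h0
        rcases ha' h0 with h | h
        · omega
        · exact h hI
      · left
        refine ⟨n, by simp [h1, hn], hcn, by omega⟩
    · rw [hLS w hwx]
      have : (if n = 1 then Function.update σ x SiteState.sleeping else σ) w = σ w := by
        split_ifs <;> simp [hwx]
      rw [this]; exact hold
  | some z =>
    simp only [dlt]
    by_cases hwx : w = x
    · subst hwx
      left
      by_cases hz : w + z = w
      · refine ⟨n, ?_, by simp [hz, hcn], ?_⟩
        · simp [hz, hw, addParticle]; omega
        · intro _ _; rw [hLSx, hI]; simp
      · refine ⟨n - 1, ?_, by simp [hz, hcn]; omega, ?_⟩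
        · split_ifs <;> simp [Ne.symm hz]
        · intro _ _; rw [hLSx, hI]; simp
    · rw [hLS w hwx]
      have hxw : ¬ x = w := fun h => hwx h.symm
      by_cases hz : x + z = w
      · left
        subst hz
        simp only [hw, if_true, Function.update_self, Function.update_of_ne hwx, hxw, if_false]
        rcases hold with ⟨k, hk, hck, hLk⟩ | ⟨hk, h0, hck, hLk⟩
        · refine ⟨k + 1, by simp [hk, addParticle], by simp [hck], ?_⟩
          intro h1 h2
          exact hLk h1 (by omega)
        · exact ⟨2, by simp [hk, addParticle], by simp [hck], by omega⟩
      · have hzw : w ≠ x + z := fun h => hz h.symm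
        have : (if x + z ∈ V then Function.update (Function.update σ x (SiteState.active (n - 1)))
            (x + z) (addParticle (Function.update σ x (SiteState.active (n - 1)) (x + z)))
            else Function.update σ x (SiteState.active (n - 1))) w = σ w := by
          split_ifs <;> simp [hwx, hzw]
        rw [this]
        simpa [hz, hxw] using hold

lemma topple_snd (V : Finset (Site d)) (I : Stacks d) (x : Site d) (s : State d) :
    (topple V I x s).2 = Function.update s.2 x (s.2 x + 1) := rfl

lemma topple_le {V : Finset (Site d)} {I : Stacks d} {x : Site d} {s : State d} {m : Site d → ℕ}
    (hle : ∀ x ∈ V, s.2 x ≤ m x) (h : s.2 x < m x) : ∀ y ∈ V, (topple V I x s).2 y ≤ m y := by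
  intro y hy
  rw [topple_snd]
  by_cases hyx : y = x
  · subst hyx; simpa using h
  · simpa [hyx] using hle y hy

lemma le_topple (V : Finset (Site d)) (I : Stacks d) (x : Site d) (s : State d) (y : Site d) :
    s.2 y ≤ (topple V I x s).2 y := by
  rw [topple_snd]
  by_cases hyx : y = x
  · subst hyx; simp
  · simp [hyx]

/-- Good states: invariant and odometer below `m`. -/
def Good (V : Finset (Site d)) (I : Stacks d) (ζ : Site d → ℤ) (m : Site d → ℕ) (s : State d) :
    Prop := Inv V I ζ s ∧ ∀ x ∈ V, s.2 x ≤ m x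

lemma Good.topple {V : Finset (Site d)} {I : Stacks d} {ζ : Site d → ℤ} {m : Site d → ℕ}
    {s : State d} (hs : Good V I ζ m s) (hm : Stab V I ζ m) {x : Site d} (hx : x ∈ V)
    (ha : 1 ≤ numActive (s.1 x))
    (ha' : x = 0 → 2 ≤ numActive (s.1 x) ∨ I (x, s.2 x) ≠ none) :
    Good V I ζ m (topple V I x s) :=
  ⟨Inv_topple hs.1 hx ha ha', topple_le hs.2 (lt_of_active hs.1 hm hs.2 hx ha)⟩

lemma Good.run {V : Finset (Site d)} {I : Stacks d} {ζ : Site d → ℤ} {m : Site d → ℕ}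
    (hm : Stab V I ζ m) (l : List (Site d)) : ∀ {s : State d}, Good V I ζ m s → WLegal V I s l →
    Good V I ζ m (run V I s l) ∧ s.2 0 ≤ (run V I s l).2 0 := by
  induction l with
  | nil => intro s hs _; exact ⟨hs, le_rfl⟩
  | cons x l ih =>
    intro s hs hl
    obtain ⟨hx, ha, hl⟩ := hl
    have hg : Good V I ζ m (ARW.topple V I x s) := by
      refine hs.topple hm hx ?_ ?_
      · split_ifs at ha <;> omega
      · intro h; simp only [h, if_true] at ha ⊢; exact Or.inl ha
    have := ih hg hl
    exact ⟨this.1, (le_topple V I x s 0).trans this.2⟩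

lemma exists_weak {V : Finset (Site d)} (h0 : (0 : Site d) ∈ V) {I : Stacks d} {ζ : Site d → ℤ}
    {m : Site d → ℕ} (hm : Stab V I ζ m) (N : ℕ) : ∀ {s : State d}, Good V I ζ m s →
    ∑ x ∈ V, m x ≤ ∑ x ∈ V, s.2 x + N → ∃ l, WLegal V I s l ∧ WStable V (run V I s l).1 := by
  have key : ∀ {s : State d}, Good V I ζ m s → ¬ WStable V s.1 →
      ∃ x ∈ V, (if x = 0 then 2 else 1) ≤ numActive (s.1 x) := by
    intro s hs hst
    by_contra hcon
    push Not at hcon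
    apply hst
    refine ⟨?_, fun x hx hx0 => ?_⟩
    · have := hcon 0 h0; simp at this; omega
    · have := hcon x hx; simp [hx0] at this; omega
  induction N with
  | zero =>
    intro s hs hN
    by_cases hst : WStable V s.1
    · exact ⟨[], trivial, hst⟩
    exfalso
    obtain ⟨x, hx, ha⟩ := key hs hst
    have := lt_of_active hs.1 hm hs.2 hx (by split_ifs at ha <;> omega)
    have := Finset.sum_lt_sum hs.2 ⟨x, hx, this⟩
    omega
  | succ N ih =>
    intro s hs hN
    by_cases hst : WStable V s.1
    · exact ⟨[], trivial, hst⟩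
    obtain ⟨x, hx, ha⟩ := key hs hst
    have hg : Good V I ζ m (ARW.topple V I x s) := by
      refine hs.topple hm hx ?_ ?_
      · split_ifs at ha <;> omega
      · intro h; simp only [h, if_true] at ha ⊢; exact Or.inl ha
    obtain ⟨l, hl, hl'⟩ := ih hg (by
      have : ∑ y ∈ V, s.2 y < ∑ y ∈ V, (ARW.topple V I x s).2 y := by
        refine Finset.sum_lt_sum (fun y _ => le_topple V I x s y) ⟨x, hx, ?_⟩
        rw [topple_snd]; simp
      omega)
    exact ⟨x :: l, ⟨hx, ha, hl⟩, hl'⟩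

lemma Good.weakStab {V : Finset (Site d)} (h0 : (0 : Site d) ∈ V) {I : Stacks d}
    {ζ : Site d → ℤ} {m : Site d → ℕ} (hm : Stab V I ζ m) {s : State d} (hs : Good V I ζ m s) :
    Good V I ζ m (weakStab V I s) ∧ s.2 0 ≤ (weakStab V I s).2 0 ∧ WStable V (weakStab V I s).1 := by
  have h := exists_weak h0 hm _ hs (Nat.le_add_left _ _)
  unfold ARW.weakStab
  rw [dif_pos h]
  have := Good.run hm _ hs h.choose_spec.1
  exact ⟨this.1, this.2, h.choose_spec.2⟩

/-- Executing a sleep instruction at the origin without effect. -/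
lemma Good.skip {V : Finset (Site d)} (h0 : (0 : Site d) ∈ V) {I : Stacks d}
    {ζ : Site d → ℤ} {m : Site d → ℕ} (hm : Stab V I ζ m) {s : State d} (hs : Good V I ζ m s)
    (ha : 1 ≤ numActive (s.1 0)) (hI : I (0, s.2 0) = none) :
    Good V I ζ m (s.1, Function.update s.2 0 (s.2 0 + 1)) := by
  refine ⟨?_, topple_le (I := I) hs.2 (lt_of_active hs.1 hm hs.2 h0 ha)⟩
  intro w hw
  have := hs.1 w hw
  simp only
  rw [cnt_succ I ζ s.2 h0 w, hI]
  simp only [dlt, add_zero]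
  by_cases hw0 : w = 0
  · subst hw0; simpa using this
  · simpa [LS, hw0] using this

lemma Good.skips {V : Finset (Site d)} (h0 : (0 : Site d) ∈ V) {I : Stacks d}
    {ζ : Site d → ℤ} {m : Site d → ℕ} (hm : Stab V I ζ m) {s : State d} (hs : Good V I ζ m s)
    (ha : 1 ≤ numActive (s.1 0)) (k : ℕ) (hI : ∀ i < k, I (0, s.2 0 + i) = none) :
    Good V I ζ m (s.1, Function.update s.2 0 (s.2 0 + k)) := by
  induction k with
  | zero => simpa using hs
  | succ k ih =>
    have := (ih fun i hi => hI i (by omega)).skip h0 hm ha (by simpa using hI k (by omega))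
    simpa [add_assoc] using this

lemma Good.jumpOut {V : Finset (Site d)} (h0 : (0 : Site d) ∈ V) {I : Stacks d}
    {ζ : Site d → ℤ} {m : Site d → ℕ} (hm : Stab V I ζ m) {s : State d} (hs : Good V I ζ m s)
    (ha : 1 ≤ numActive (s.1 0)) :
    Good V I ζ m (jumpOut V I s) ∧ J I (s.2 0) + 1 ≤ J I ((jumpOut V I s).2 0) := by
  have hex : ∃ k, (I (0, s.2 0 + k)).isSome := by
    by_contra hcon
    push Not at hcon
    have := hs.skips h0 hm ha (m 0 + 1) (fun i _ => by simpa using hcon i)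
    have := this.2 0 h0
    simp at this
    omega
  have hnone : ∀ i < Nat.find hex, I (0, s.2 0 + i) = none := fun i hi => by
    simpa using Nat.find_min hex hi
  have hg := hs.skips h0 hm ha (Nat.find hex) hnone
  obtain ⟨z, hz⟩ := Option.isSome_iff_exists.1 (Nat.find_spec hex)
  have heq : ARW.jumpOut V I s
      = ARW.topple V I 0 (s.1, Function.update s.2 0 (s.2 0 + Nat.find hex)) := by
    unfold ARW.jumpOut ARW.topple
    rw [dif_pos hex]
    simp [hz]
  have hg' := hg.topple hm h0 ha (fun _ => Or.inr (by simp [hz]))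
  rw [heq]
  refine ⟨hg', ?_⟩
  rw [topple_snd]
  simp only [Function.update_self]
  rw [J_succ]
  simp only [hz, Option.isSome_some, if_true]
  have := J_mono I (Nat.le_add_right (s.2 0) (Nat.find hex))
  omega

/-- Counts of the initial configuration. -/
def zet (η : Site d → ℕ) : Site d → ℤ := fun x => η x

lemma Good.init (V : Finset (Site d)) (I : Stacks d) (η : Site d → ℕ) (m : Site d → ℕ) :
    Good V I (zet η) m (initState d V η) := by
  refine ⟨fun x hx => Or.inl ⟨η x, by simp [initState, hx], ?_, ?_⟩, fun x _ => by simp [initState]⟩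
  · simp [cnt, initState, zet]
  · rintro _ _ ⟨k, hk, _⟩
    simp [initState] at hk

lemma Good.proc {V : Finset (Site d)} (h0 : (0 : Site d) ∈ V) {I : Stacks d}
    {η : Site d → ℕ} {m : Site d → ℕ} (hm : Stab V I (zet η) m) (j : ℕ) :
    Good V I (zet η) m (procState V I η j) ∧ WStable V (procState V I η j).1 ∧
    ((∀ i < j, numActive ((procState V I η i).1 0) ≠ 0) →
      J I ((procState V I η 0).2 0) + j ≤ J I ((procState V I η j).2 0)) := by
  induction j with
  | zero =>
    have := (Good.init V I η m).weakStab h0 hm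
    exact ⟨this.1, this.2.2, fun _ => le_rfl⟩
  | succ j ih =>
    obtain ⟨hg, hw, hJ⟩ := ih
    have hsucc : procState V I η (j + 1) = if 1 ≤ numActive ((procState V I η j).1 0) then
        ARW.weakStab V I (ARW.jumpOut V I (procState V I η j)) else procState V I η j := rfl
    rw [hsucc]
    by_cases ha : 1 ≤ numActive ((procState V I η j).1 0)
    · rw [if_pos ha]
      obtain ⟨hg1, hJ1⟩ := hg.jumpOut h0 hm ha
      obtain ⟨hg2, hJ2, hw2⟩ := hg1.weakStab h0 hm
      refine ⟨hg2, hw2, fun h => ?_⟩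
      have h3 := hJ fun i hi => h i (by omega)
      have h4 := J_mono I hJ2
      omega
    · rw [if_neg ha]
      refine ⟨hg, hw, fun h => ?_⟩
      have := h j (by omega)
      omega

/-- Unit mass at `x`. -/
def del (x : Site d) : Site d → ℤ := fun w => if x = w then 1 else 0

lemma stab_weak {V : Finset (Site d)} {I : Stacks d} {ζ : Site d → ℤ} {s : State d}
    (hs : Inv V I ζ s) (hw : WStable V s.1) : Stab V I (ζ - del 0) s.2 := by
  intro x hx
  have hc : cnt V I (ζ - del 0) s.2 x = cnt V I ζ s.2 x - (if 0 = x then 1 else 0) := by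
    simp [cnt, del]; ring
  rw [hc]
  rcases hs x hx with ⟨n, hn, hcn, hL⟩ | ⟨hn, h1, h2, h3⟩
  · left
    by_cases hx0 : x = 0
    · subst hx0
      have := hw.1
      rw [hn] at this; simp [numActive] at this
      simp; omega
    · have := hw.2 x hx hx0
      rw [hn] at this; simp [numActive] at this
      simp [Ne.symm hx0]; omega
  · right
    exact ⟨h1, by simp [Ne.symm h1, h2], h3⟩

lemma chances_le {V : Finset (Site d)} (h0 : (0 : Site d) ∈ V) {I : Stacks d}
    {η : Site d → ℕ} (hex : ∃ m, Stab V I (zet η) m) :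
    ∃ m₀ : Site d → ℕ, Stab V I (zet η - del 0) m₀ ∧ ∃ c : ℕ, chances V I η = c ∧
      ∀ m, Stab V I (zet η) m → c + J I (m₀ 0) ≤ J I (m 0) := by
  obtain ⟨m, hm⟩ := hex
  have hp := Good.proc (η := η) h0 hm 0
  refine ⟨(procState V I η 0).2, stab_weak hp.1.1 hp.2.1, ?_⟩
  have hch : ∃ j, numActive ((procState V I η j).1 0) = 0 := by
    by_contra hcon
    push Not at hcon
    have h1 := Good.proc (η := η) h0 hm (J I (m 0) + 1)
    have h2 := h1.2.2 (fun i _ => hcon i)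
    have h3 := J_mono I (h1.1.2 0 h0)
    omega
  refine ⟨Nat.find hch, ?_, fun m hm => ?_⟩
  · unfold chances; rw [dif_pos hch]
  · have h1 := Good.proc (η := η) h0 hm (Nat.find hch)
    have h2 := h1.2.2 (fun i hi => Nat.find_min hch hi)
    have h3 := J_mono I (h1.1.2 0 h0)
    omega

/-- Minimal number of jumps at the origin over stabilizing odometers. -/
def X (V : Finset (Site d)) (ζ : Site d → ℤ) (I : Stacks d) : ℝ≥0∞ :=
  ⨅ m : Site d →₀ ℕ, if Stab V I ζ m then (J I (m 0) : ℝ≥0∞) else ⊤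

lemma stab_congr {V : Finset (Site d)} {I : Stacks d} {ζ ζ' : Site d → ℤ} {m m' : Site d → ℕ}
    (hζ : ∀ x ∈ V, ζ x = ζ' x) (hm : ∀ x ∈ V, m x = m' x) (h : Stab V I ζ m) :
    Stab V I ζ' m' := by
  intro x hx
  have hc : cnt V I ζ' m' x = cnt V I ζ m x := by
    unfold cnt
    rw [hζ x hx]
    congr 1
    refine Finset.sum_congr rfl fun y hy => ?_
    rw [hm y hy]
  have := h x hx
  rw [hc]
  simpa only [LS, hm x hx] using this

lemma X_le {V : Finset (Site d)} (h0 : (0 : Site d) ∈ V) {I : Stacks d} {ζ : Site d → ℤ}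
    {m : Site d → ℕ} (h : Stab V I ζ m) : X V ζ I ≤ J I (m 0) := by
  let m' : Site d →₀ ℕ := Finsupp.onFinset V (fun x => if x ∈ V then m x else 0) (by
    intro a; simp only [ne_eq]; split_ifs <;> simp [*])
  have hm' : ∀ x ∈ V, m x = m' x := by intro x hx; simp [m', hx]
  refine (iInf_le _ m').trans ?_
  rw [if_pos (stab_congr (fun _ _ => rfl) hm' h), hm' 0 h0]

lemma exists_of_X_ne_top {V : Finset (Site d)} {I : Stacks d} {ζ : Site d → ℤ}
    (h : X V ζ I ≠ ⊤) : ∃ m : Site d → ℕ, Stab V I ζ m ∧ X V ζ I = J I (m 0) := by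
  have hne : ∃ m : Site d →₀ ℕ, Stab V I ζ m := by
    by_contra hcon
    push Not at hcon
    exact h (by simp [X, hcon])
  let S : Set ℕ := {n | ∃ m : Site d →₀ ℕ, Stab V I ζ m ∧ J I (m 0) = n}
  have hS : S.Nonempty := by obtain ⟨m, hm⟩ := hne; exact ⟨_, m, hm, rfl⟩
  obtain ⟨m, hm, hJ⟩ := Nat.sInf_mem hS
  refine ⟨m, hm, le_antisymm ?_ ?_⟩
  · refine (iInf_le _ m).trans ?_
    rw [if_pos hm]
  · refine le_iInf fun m' => ?_
    split_ifs with hm'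
    · rw [hJ]
      have : sInf S ≤ J I (m' 0) := Nat.sInf_le ⟨m', hm', rfl⟩
      exact_mod_cast this
    · exact le_top

lemma X_congr {V : Finset (Site d)} {I : Stacks d} {ζ ζ' : Site d → ℤ}
    (hζ : ∀ x ∈ V, ζ x = ζ' x) : X V ζ I = X V ζ' I := by
  unfold X
  congr 1; funext m
  have : Stab V I ζ m ↔ Stab V I ζ' m :=
    ⟨stab_congr hζ fun _ _ => rfl, stab_congr (fun x hx => (hζ x hx).symm) fun _ _ => rfl⟩
  simp [this]

lemma measurable_coord (p : Site d × ℕ) : Measurable fun I : Stacks d => I p := measurable_pi_apply p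

lemma measurable_of_coord {β : Type*} [MeasurableSpace β] (p : Site d × ℕ) (f : Instr d → β) :
    Measurable fun I : Stacks d => f (I p) :=
  (measurable_from_top (f := f)).comp (measurable_coord p)

lemma measurable_J (n : ℕ) : Measurable fun I : Stacks d => J I n := by
  unfold J
  exact Finset.measurable_sum _ fun k _ =>
    measurable_of_coord (0, k) (fun i => if i.isSome then 1 else 0)

lemma measurable_cnt (V : Finset (Site d)) (ζ : Site d → ℤ) (m : Site d → ℕ) (w : Site d) :
    Measurable fun I : Stacks d => cnt V I ζ m w := by
  unfold cnt
  exact measurable_const.add (Finset.measurable_sum _ fun y _ => Finset.measurable_sum _ fun k _ =>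
    measurable_of_coord (y, k) (fun i => dlt y i w))

lemma measurableSet_LS (m : Site d → ℕ) (x : Site d) :
    MeasurableSet {I : Stacks d | LS I m x} := by
  unfold LS
  simp only [Set.ofPred_exists]
  refine MeasurableSet.iUnion fun k => ?_
  by_cases h : m x = k + 1
  · simp only [h, true_and]
    exact measurable_coord (x, k) (MeasurableSet.of_discrete (s := {none}))
  · simp [h]

lemma measurableSet_Stab (V : Finset (Site d)) (ζ : Site d → ℤ) (m : Site d → ℕ) :
    MeasurableSet {I : Stacks d | Stab V I ζ m} := by
  have : {I : Stacks d | Stab V I ζ m} = ⋂ x ∈ V, ({I : Stacks d | cnt V I ζ m x ≤ 0} ∪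
      ({I | x ≠ 0} ∩ ({I : Stacks d | cnt V I ζ m x = 1} ∩ {I | LS I m x}))) := by
    ext I; simp [Stab]
  rw [this]
  refine Finset.measurableSet_biInter _ fun x _ => ?_
  refine MeasurableSet.union ?_ (MeasurableSet.inter (MeasurableSet.const _)
    (MeasurableSet.inter ?_ (measurableSet_LS m x)))
  · exact measurable_cnt V ζ m x (MeasurableSet.of_discrete (s := {a : ℤ | a ≤ 0}))
  · exact measurable_cnt V ζ m x (MeasurableSet.of_discrete (s := {a : ℤ | a = 1}))

lemma measurable_X (V : Finset (Site d)) (ζ : Site d → ℤ) : Measurable (X V ζ) := by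
  unfold X
  refine Measurable.iInf fun m => Measurable.ite (measurableSet_Stab V ζ m) ?_ measurable_const
  exact (measurable_from_top (f := fun n : ℕ => (n : ℝ≥0∞))).comp (measurable_J _)

/-- Remove the first instruction at `x`. -/
def sh (x : Site d) (I : Stacks d) : Stacks d := fun p => if p.1 = x then I (x, p.2 + 1) else I p

/-- Position of a particle at `x` after instruction `i`. -/
def nxt (x : Site d) (i : Instr d) : Site d :=
  match i with
  | none => x
  | some z => x + z

/-- Reward: one for each jump from the origin. -/
def rew (x : Site d) (i : Instr d) : ℕ := if x = 0 ∧ i.isSome then 1 else 0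

lemma stab_shift {V : Finset (Site d)} {I : Stacks d} {ζ : Site d → ℤ} {m : Site d → ℕ}
    {x : Site d} (hx : x ∈ V) (h : Stab V (sh x I) (ζ + del (nxt x (I (x, 0)))) m) :
    Stab V I (ζ + del x) (Function.update m x (m x + 1)) := by
  have hc : ∀ w, cnt V I (ζ + del x) (Function.update m x (m x + 1)) w
      = cnt V (sh x I) (ζ + del (nxt x (I (x, 0)))) m w := by
    intro w
    unfold cnt
    have : ∀ y ∈ V, ∑ k ∈ Finset.range (Function.update m x (m x + 1) y), dlt y (I (y, k)) w
      = ∑ k ∈ Finset.range (m y), dlt y (sh x I (y, k)) w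
        + (if y = x then dlt x (I (x, 0)) w else 0) := by
      intro y _
      by_cases h : y = x
      · subst h; simp [Finset.sum_range_succ', sh]
      · simp [h, sh]
    rw [Finset.sum_congr rfl this, Finset.sum_add_distrib]
    simp only [Finset.sum_ite_eq', hx, if_true, Pi.add_apply]
    have : del x w + dlt x (I (x, 0)) w = del (nxt x (I (x, 0))) w := by
      cases I (x, 0) <;> simp [del, dlt, nxt] <;> congr
    linarith
  intro w hw
  rw [hc]
  rcases h w hw with h | ⟨h1, h2, k, hk, hk'⟩
  · exact Or.inl h
  · refine Or.inr ⟨h1, h2, ?_⟩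
    by_cases hwx : w = x
    · subst hwx
      exact ⟨k + 1, by simp [hk], by simpa [sh] using hk'⟩
    · exact ⟨k, by simp [hwx, hk], by simpa [sh, hwx] using hk'⟩

lemma X_shift {V : Finset (Site d)} (h0 : (0 : Site d) ∈ V) (I : Stacks d) (ζ : Site d → ℤ)
    {x : Site d} (hx : x ∈ V) :
    X V (ζ + del x) I ≤ rew x (I (x, 0)) + X V (ζ + del (nxt x (I (x, 0)))) (sh x I) := by
  by_cases htop : X V (ζ + del (nxt x (I (x, 0)))) (sh x I) = ⊤
  · rw [htop]; simp
  obtain ⟨m, hm, hJ⟩ := exists_of_X_ne_top htop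
  refine (X_le h0 (stab_shift hx hm)).trans ?_
  rw [hJ]
  have : J I (Function.update m x (m x + 1) 0) = rew x (I (x, 0)) + J (sh x I) (m 0) := by
    by_cases hx0 : x = 0
    · subst hx0
      simp only [Function.update_self, J, Finset.sum_range_succ', sh, if_true, rew, true_and]
      ring
    · have : (0 : Site d) ≠ x := Ne.symm hx0
      simp [J, sh, rew, hx0, this]
  rw [this]; push_cast; exact le_rfl

/-- Cylinder sets. -/
def cyls (d : ℕ) : Set (Set (Stacks d)) :=
  {S | ∃ (F : Finset (Site d × ℕ)) (g : Site d × ℕ → Instr d), S = {I | ∀ i ∈ F, I i = g i}}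

lemma measurableSet_cyl (F : Finset (Site d × ℕ)) (g : Site d × ℕ → Instr d) :
    MeasurableSet {I : Stacks d | ∀ i ∈ F, I i = g i} := by
  have : {I : Stacks d | ∀ i ∈ F, I i = g i} = ⋂ i ∈ F, {I : Stacks d | I i = g i} := by
    ext I; simp
  rw [this]
  exact Finset.measurableSet_biInter _ fun i _ =>
    measurable_coord i (MeasurableSet.of_discrete (s := {g i}))

lemma cyls_pi : IsPiSystem (cyls d) := by
  rintro _ ⟨F, g, rfl⟩ _ ⟨F', g', rfl⟩ ⟨I₀, h1, h2⟩
  refine ⟨F ∪ F', I₀, ?_⟩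
  ext I
  simp only [Set.mem_inter_iff, Set.mem_ofPred_eq, Finset.mem_union] at h1 h2 ⊢
  constructor
  · rintro ⟨a, b⟩ i (hi | hi)
    · rw [a i hi, h1 i hi]
    · rw [b i hi, h2 i hi]
  · intro h
    exact ⟨fun i hi => (h i (Or.inl hi)).trans (h1 i hi),
      fun i hi => (h i (Or.inr hi)).trans (h2 i hi)⟩

lemma cyls_gen : (MeasurableSpace.pi : MeasurableSpace (Stacks d))
    = MeasurableSpace.generateFrom (cyls d) := by
  apply le_antisymm
  · refine iSup_le fun p => ?_
    rintro _ ⟨A, _, rfl⟩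
    have : (fun I : Stacks d => I p) ⁻¹' A = ⋃ a ∈ A, {I : Stacks d | I p = a} := by
      ext I; simp
    rw [this]
    refine MeasurableSet.biUnion (Set.to_countable A) fun a _ => ?_
    apply MeasurableSpace.measurableSet_generateFrom
    exact ⟨{p}, fun _ => a, by simp⟩
  · refine MeasurableSpace.generateFrom_le ?_
    rintro _ ⟨F, g, rfl⟩
    exact measurableSet_cyl F g

lemma measurable_sh (x : Site d) : Measurable (sh x) := by
  refine measurable_pi_lambda _ fun p => ?_
  unfold sh
  split_ifs
  · exact measurable_coord _
  · exact measurable_coord _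

/-- The shift of indices. -/
def up (x : Site d) (p : Site d × ℕ) : Site d × ℕ := if p.1 = x then (x, p.2 + 1) else p

lemma up_inj (x : Site d) : Function.Injective (up x) := by
  rintro ⟨y, k⟩ ⟨y', k'⟩ h
  unfold up at h
  simp only at h
  split_ifs at h with h1 h2 h2
  · subst h1; subst h2; simpa using h
  · exact absurd (by simpa using (congrArg Prod.fst h).symm) h2
  · exact absurd (by simpa using (congrArg Prod.fst h)) h1
  · exact h

lemma sh_apply (x : Site d) (I : Stacks d) (p : Site d × ℕ) : sh x I p = I (up x p) := by
  unfold sh up; split_ifs <;> rfl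

lemma up_ne (x : Site d) (p : Site d × ℕ) : up x p ≠ (x, 0) := by
  unfold up
  split_ifs with h
  · simp
  · intro h'; exact h (by rw [h'])

lemma law_shift {step : Site d → ℝ} {lam : ℝ} {μ : Measure (Stacks d)}
    (hμ : IsStackLaw d step lam μ) (x : Site d) (i : Instr d) :
    (μ.restrict {I | I (x, 0) = i}).map (sh x) = instrWeight step lam i • μ := by
  have := hμ.1
  have hcyl : ∀ (F : Finset (Site d × ℕ)) (g : Site d × ℕ → Instr d),
      (μ.restrict {I | I (x, 0) = i}).map (sh x) {I | ∀ i ∈ F, I i = g i}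
        = instrWeight step lam i * μ {I | ∀ i ∈ F, I i = g i} := by
    intro F g
    rw [Measure.map_apply (measurable_sh x) (measurableSet_cyl F g),
      Measure.restrict_apply (measurable_sh x (measurableSet_cyl F g)), hμ.2]
    let g' : Site d × ℕ → Instr d := fun p =>
      if p.1 = x then (if p.2 = 0 then i else g (x, p.2 - 1)) else g p
    have hg0 : g' (x, 0) = i := by simp [g']
    have hgu : ∀ p, g' (up x p) = g p := by
      rintro ⟨y, k⟩
      simp only [g', up]
      by_cases h : y = x
      · subst h; simp
      · simp [h]
    have hset : sh x ⁻¹' {I | ∀ i ∈ F, I i = g i} ∩ {I | I (x, 0) = i}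
        = {I | ∀ p ∈ insert (x, 0) (F.image (up x)), I p = g' p} := by
      ext I
      simp only [Set.mem_inter_iff, Set.mem_preimage, Set.mem_ofPred_eq, Finset.forall_mem_insert,
        Finset.forall_mem_image, hg0, hgu, sh_apply]
      tauto
    have hnot : (x, 0) ∉ F.image (up x) := by
      simp only [Finset.mem_image, not_exists, not_and]
      exact fun p _ => up_ne x p
    rw [hset, hμ.2, Finset.prod_insert hnot, Finset.prod_image (fun a _ b _ h => up_inj x h), hg0]
    simp only [hgu]
  refine MeasureTheory.ext_of_generate_finite (cyls d) cyls_gen cyls_pi ?_ ?_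
  · rintro _ ⟨F, g, rfl⟩
    rw [hcyl]; simp
  · have := hcyl ∅ (fun _ => none)
    simpa using this

lemma lintegral_shift {step : Site d → ℝ} {lam : ℝ} {μ : Measure (Stacks d)}
    (hμ : IsStackLaw d step lam μ) (x : Site d) (f : Instr d → Stacks d → ℝ≥0∞)
    (hf : ∀ i, Measurable (f i)) :
    ∫⁻ I, f (I (x, 0)) (sh x I) ∂μ = ∑' i, instrWeight step lam i * ∫⁻ I, f i I ∂μ := by
  have hs : ∀ i : Instr d, MeasurableSet {I : Stacks d | I (x, 0) = i} := fun i =>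
    measurable_coord (x, 0) (MeasurableSet.of_discrete (s := {i}))
  have h1 : ∀ I : Stacks d, f (I (x, 0)) (sh x I)
      = ∑' i, Set.indicator {I : Stacks d | I (x, 0) = i} (fun I => f i (sh x I)) I := by
    intro I
    rw [tsum_eq_single (I (x, 0))]
    · simp
    · intro i hi
      simp [Ne.symm hi]
  simp_rw [h1]
  have hm : ∀ i, AEMeasurable (Set.indicator {I : Stacks d | I (x, 0) = i}
      (fun I => f i (sh x I))) μ :=
    fun i => (((hf i).comp (measurable_sh x)).indicator (hs i)).aemeasurable
  rw [lintegral_tsum hm]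
  congr 1; funext i
  rw [lintegral_indicator (hs i), ← lintegral_map (hf i) (measurable_sh x), law_shift hμ,
    lintegral_smul_measure, smul_eq_mul]

/-- Comparison lemma. -/
lemma comparison (V : Finset (Site d)) (w : Instr d → ℝ≥0∞) (hw : ∑' i, w i = 1)
    (r : Site d → Instr d → ℝ≥0∞) (F H h : Site d → ℝ≥0∞) (c M : ℝ≥0∞) (C : ℕ)
    (hM : M ≠ ⊤) (hFM : ∀ x, F x ≤ M)
    (hFc : ∀ x ∉ V, F x = c)
    (hF : ∀ x ∈ V, F x ≤ ∑' i, w i * (r x i + F (nxt x i)))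
    (hH : ∀ x ∈ V, ∑' i, w i * (r x i + H (nxt x i)) ≤ H x)
    (hh1 : ∀ x ∈ V, 1 ≤ h x) (hhC : ∀ x ∈ V, h x ≤ C)
    (hh : ∀ x ∈ V, ∑' i, w i * h (nxt x i) + 1 ≤ h x) (x : Site d) : F x ≤ c + H x := by
  by_cases hxV : x ∈ V
  swap
  · rw [hFc x hxV]; exact le_self_add
  have hC1 : (1 : ℝ) ≤ C := by
    have := (hh1 x hxV).trans (hhC x hxV)
    exact_mod_cast this
  set ρ : ℝ≥0∞ := ENNReal.ofReal (1 - 1 / C) with hρ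
  have hρ1 : ρ < 1 := by
    rw [hρ, ENNReal.ofReal_lt_one]
    have : (0 : ℝ) < 1 / C := by positivity
    linarith
  have hcontr : ∀ x ∈ V, ∑' i, w i * h (nxt x i) ≤ ρ * h x := by
    intro x hx
    have hfin : h x ≠ ⊤ := ne_top_of_le_ne_top (by simp) (hhC x hx)
    have hSfin : ∑' i, w i * h (nxt x i) ≠ ⊤ :=
      ne_top_of_le_ne_top hfin (le_self_add.trans (hh x hx))
    have e1 := hh x hx
    have e2 := hhC x hx
    generalize ∑' i, w i * h (nxt x i) = S at *
    lift S to NNReal using hSfin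
    generalize h x = b at *
    lift b to NNReal using hfin
    have e1' : (S : ℝ) + 1 ≤ b := by exact_mod_cast e1
    have e2' : (b : ℝ) ≤ C := by exact_mod_cast e2
    have hb : (b : ℝ≥0∞) = ENNReal.ofReal b := by simp
    have hS : (S : ℝ≥0∞) = ENNReal.ofReal S := by simp
    rw [hb, hS, hρ, ← ENNReal.ofReal_mul]
    · apply ENNReal.ofReal_le_ofReal
      have : (b : ℝ) / C ≤ 1 := by rw [div_le_one (by linarith)]; exact e2'
      have e3 : (1 - 1 / (C : ℝ)) * b = b - b / C := by ring
      rw [e3]; linarith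
    · have : 1 / (C : ℝ) ≤ 1 := by rw [div_le_one (by linarith)]; exact hC1
      linarith
  have main : ∀ n : ℕ, ∀ x, F x ≤ c + H x + M * ρ ^ n * h x := by
    intro n
    induction n with
    | zero =>
      intro x
      by_cases hx : x ∈ V
      · calc F x ≤ M := hFM x
          _ ≤ M * ρ ^ 0 * h x := by
            rw [pow_zero, mul_one]
            exact le_mul_of_one_le_right zero_le (hh1 x hx)
          _ ≤ _ := le_add_self
      · rw [hFc x hx, add_assoc]; exact le_self_add
    | succ n ih =>
      intro x
      by_cases hx : x ∈ V
      · calc F x ≤ ∑' i, w i * (r x i + F (nxt x i)) := hF x hx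
          _ ≤ ∑' i, (w i * c + w i * (r x i + H (nxt x i)) + M * ρ ^ n * (w i * h (nxt x i))) := by
            refine ENNReal.tsum_le_tsum fun i => ?_
            calc w i * (r x i + F (nxt x i))
                ≤ w i * (r x i + (c + H (nxt x i) + M * ρ ^ n * h (nxt x i))) := by
                  gcongr; exact ih _
              _ = _ := by ring
          _ = c + ∑' i, w i * (r x i + H (nxt x i)) + M * ρ ^ n * ∑' i, w i * h (nxt x i) := by
            rw [ENNReal.tsum_add, ENNReal.tsum_add, ENNReal.tsum_mul_right, hw, one_mul,
              ENNReal.tsum_mul_left]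
          _ ≤ c + H x + M * ρ ^ n * (ρ * h x) := by
            gcongr
            · exact hH x hx
            · exact hcontr x hx
          _ = _ := by ring
      · rw [hFc x hx, add_assoc]; exact le_self_add
  have hlim : Tendsto (fun n : ℕ => c + H x + M * ρ ^ n * h x) atTop (𝓝 (c + H x + M * 0 * h x)) := by
    refine Tendsto.add tendsto_const_nhds ?_
    have hfin : h x ≠ ⊤ := ne_top_of_le_ne_top (by simp) (hhC x hxV)
    refine ENNReal.Tendsto.mul_const ?_ (Or.inr hfin)
    refine ENNReal.Tendsto.const_mul ?_ (Or.inr hM)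
    exact ENNReal.tendsto_pow_atTop_nhds_zero_of_lt_one hρ1
  have := ge_of_tendsto' hlim fun n => main n x
  simpa using this

/-- `n`-step probabilities of being at the origin, started from `x`. -/
def pn (s : Site d → ℝ≥0∞) : ℕ → Site d → ℝ≥0∞
  | 0 => fun x => if x = 0 then 1 else 0
  | n + 1 => fun x => ∑' z, s z * pn s n (x + z)

lemma tsum_fin_succ (n : ℕ) (f : (Fin (n + 1) → Site d) → ℝ≥0∞) :
    ∑' w, f w = ∑' z : Site d, ∑' w : Fin n → Site d, f (Fin.cons z w) := by
  rw [← (Fin.consEquiv (fun _ : Fin (n + 1) => Site d)).tsum_eq f, ENNReal.tsum_prod']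
  rfl

lemma pn_eq (s : Site d → ℝ≥0∞) (n : ℕ) : ∀ x : Site d,
    pn s n x = ∑' w : Fin n → Site d, if x + ∑ i, w i = 0 then ∏ i, s (w i) else 0 := by
  induction n with
  | zero => intro x; simp [pn]
  | succ n ih =>
    intro x
    rw [tsum_fin_succ]
    simp only [pn]
    congr 1; funext z
    rw [ih, ← ENNReal.tsum_mul_left]
    congr 1; funext w
    rw [Fin.sum_univ_succ, Fin.prod_univ_succ]
    simp [add_assoc]

lemma tsum_path (s : Site d → ℝ≥0∞) (hs : ∑' z, s z = 1) (n : ℕ) :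
    ∑' w : Fin n → Site d, ∏ i, s (w i) = 1 := by
  induction n with
  | zero => simp
  | succ n ih =>
    rw [tsum_fin_succ]
    simp only [Fin.prod_univ_succ, Fin.cons_zero, Fin.cons_succ, ENNReal.tsum_mul_left, ih, mul_one,
      hs]

lemma tsum_step {step : Site d → ℝ} (h0 : ∀ z, 0 ≤ step z) (h1 : HasSum step 1) :
    ∑' z, ENNReal.ofReal (step z) = 1 := by
  rw [← ENNReal.ofReal_tsum_of_nonneg h0 h1.summable, h1.tsum_eq]; simp

lemma probAt0_eq {step : Site d → ℝ} (h0 : ∀ z, 0 ≤ step z) (h1 : HasSum step 1) (n : ℕ) :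
    ENNReal.ofReal (probAt0 step n) = pn (fun z => ENNReal.ofReal (step z)) n 0 := by
  have hps : ∀ w : Fin n → Site d, psum w n = ∑ i, w i := by
    intro w; unfold psum
    rw [Finset.filter_true_of_mem]
    intro i _; exact i.2
  have hpp : ∀ w : Fin n → Site d,
      ENNReal.ofReal (pathProb step w) = ∏ i, ENNReal.ofReal (step (w i)) := by
    intro w; unfold pathProb
    exact ENNReal.ofReal_prod_of_nonneg fun i _ => h0 _
  have hpp0 : ∀ w : Fin n → Site d, 0 ≤ pathProb step w := fun w =>
    Finset.prod_nonneg fun i _ => h0 _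
  have hsum : Summable fun w : Fin n → Site d => pathProb step w := by
    have : ∑' w : Fin n → Site d, ENNReal.ofReal (pathProb step w) ≠ ⊤ := by
      simp_rw [hpp]
      rw [tsum_path _ (tsum_step h0 h1)]; simp
    have := ENNReal.summable_toReal this
    simpa [ENNReal.toReal_ofReal, hpp0] using this
  unfold probAt0
  rw [ENNReal.ofReal_tsum_of_nonneg, pn_eq]
  · congr 1; funext w
    rw [hps, zero_add, ← hpp]
    split_ifs <;> simp
  · intro w; split_ifs
    · exact hpp0 w
    · exact le_rfl
  · refine Summable.of_nonneg_of_le ?_ ?_ hsum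
    · intro w; split_ifs
      · exact hpp0 w
      · exact le_rfl
    · intro w; split_ifs
      · exact le_rfl
      · exact hpp0 w

/-- Green's function from `x` to the origin. -/
def gr (step : Site d → ℝ) (x : Site d) : ℝ≥0∞ :=
  ∑' n, pn (fun z => ENNReal.ofReal (step z)) n x

lemma gr_zero {step : Site d → ℝ} (h0 : ∀ z, 0 ≤ step z) (h1 : HasSum step 1) :
    gr step 0 = greenE step := by
  unfold gr greenE
  congr 1; funext n
  rw [probAt0_eq h0 h1]

lemma gr_eq (step : Site d → ℝ) (x : Site d) :
    gr step x = (if x = 0 then 1 else 0) + ∑' z, ENNReal.ofReal (step z) * gr step (x + z) := by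
  unfold gr
  rw [tsum_eq_zero_add' ENNReal.summable]
  congr 1
  simp only [pn]
  rw [ENNReal.tsum_comm]
  simp_rw [ENNReal.tsum_mul_left]

lemma tsum_instr (f : Instr d → ℝ≥0∞) : ∑' i, f i = f none + ∑' z, f (some z) := by
  rw [← (Equiv.optionEquivSumPUnit.{0} (Site d)).symm.tsum_eq f]
  rw [Summable.tsum_sum ENNReal.summable ENNReal.summable]
  simp [add_comm]

lemma lam_add {lam : ℝ} (hlam : 0 < lam) :
    ENNReal.ofReal (lamS lam) + ENNReal.ofReal (lamJ lam) = 1 := by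
  unfold lamS lamJ
  rw [← ENNReal.ofReal_add (by positivity) (by positivity)]
  rw [← add_div, add_comm lam 1, div_self (by positivity)]; simp

lemma tsum_weight {step : Site d → ℝ} (h0 : ∀ z, 0 ≤ step z) (h1 : HasSum step 1)
    {lam : ℝ} (hlam : 0 < lam) : ∑' i, instrWeight step lam i = 1 := by
  rw [tsum_instr]
  simp only [instrWeight]
  rw [ENNReal.tsum_mul_left, tsum_step h0 h1, mul_one, lam_add hlam]

lemma gr_super {step : Site d → ℝ} (h0 : ∀ z, 0 ≤ step z) (h1 : HasSum step 1)
    {lam : ℝ} (hlam : 0 < lam) (x : Site d) :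
    ∑' i, instrWeight step lam i * ((rew x i : ℝ≥0∞) + gr step (nxt x i)) ≤ gr step x := by
  rw [tsum_instr]
  simp only [instrWeight, nxt]
  have e : ∑' z : Site d, ENNReal.ofReal (lamJ lam) * ENNReal.ofReal (step z)
      * ((rew x (some z) : ℝ≥0∞) + gr step (x + z)) = ENNReal.ofReal (lamJ lam) * gr step x := by
    rw [gr_eq step x]
    simp_rw [mul_assoc, mul_add]
    rw [ENNReal.tsum_add]
    congr 1
    · rw [ENNReal.tsum_mul_left]
      congr 1
      simp only [rew]
      by_cases hx : x = 0
      · simp [hx, tsum_step h0 h1]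
      · simp [hx]
    · rw [ENNReal.tsum_mul_left]
  rw [e]
  have : (rew x none : ℝ≥0∞) = 0 := by simp [rew]
  rw [this, zero_add, ← add_mul, lam_add hlam, one_mul]

lemma green_top {step : Site d → ℝ} (h0 : ∀ z, 0 ≤ step z) (h1 : HasSum step 1)
    (h : ∀ z, z ≠ 0 → step z = 0) : greenE step = ⊤ := by
  rw [← gr_zero h0 h1]
  have hs0 : ENNReal.ofReal (step 0) = 1 := by
    rw [← tsum_step h0 h1, tsum_eq_single 0]
    intro z hz; simp [h z hz]
  have hp : ∀ n, 1 ≤ pn (fun z => ENNReal.ofReal (step z)) n (0 : Site d) := by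
    intro n
    induction n with
    | zero => simp [pn]
    | succ n ih =>
      refine le_trans ?_ (ENNReal.le_tsum (0 : Site d))
      simpa [hs0] using ih
  unfold gr
  rw [← top_le_iff, ← ENNReal.tsum_const_eq_top_of_ne_zero (α := ℕ) (c := 1) one_ne_zero]
  exact ENNReal.tsum_le_tsum hp

lemma exists_h (V : Finset (Site d)) {step : Site d → ℝ} (h0 : ∀ z, 0 ≤ step z)
    (h1 : HasSum step 1) {lam : ℝ} (hlam : 0 < lam) {z : Site d} (hz : z ≠ 0) (hsz : step z ≠ 0) :
    ∃ (h : Site d → ℝ≥0∞) (C : ℕ), (∀ x ∈ V, 1 ≤ h x) ∧ (∀ x ∈ V, h x ≤ C) ∧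
      ∀ x ∈ V, ∑' i, instrWeight step lam i * h (nxt x i) + 1 ≤ h x := by
  set p := instrWeight step lam (some z) with hp
  have hp0 : p ≠ 0 := by
    have h2 : 0 < step z := lt_of_le_of_ne (h0 z) (Ne.symm hsz)
    have h3 : 0 < lamJ lam := by unfold lamJ; positivity
    simp only [hp, instrWeight]
    exact mul_ne_zero (by simpa using h3) (by simpa using h2)
  obtain ⟨R, hR⟩ : ∃ R : ℕ, 2 ≤ p * R := by
    by_cases hpt : p = ⊤
    · exact ⟨1, by simp [hpt]⟩
    obtain ⟨R, hR⟩ := ENNReal.exists_nat_gt (r := 2 / p) (ENNReal.div_ne_top (by simp) hp0)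
    refine ⟨R, ?_⟩
    rw [mul_comm]
    exact (ENNReal.div_le_iff hp0 hpt).1 hR.le
  have hR1 : 1 ≤ R := by
    rcases Nat.eq_zero_or_pos R with h | h
    · subst h; simp at hR
    · exact h
  let L : Site d → ℤ := fun y => ∑ i, z i * y i
  let φ : Site d → ℕ := fun x => (V.filter fun y => L y < L x).card
  have hL : ∀ x, L x < L (x + z) := by
    intro x
    have : L (x + z) = L x + ∑ i, z i * z i := by
      simp [L, mul_add, Finset.sum_add_distrib]
    rw [this]
    obtain ⟨i, hi⟩ : ∃ i, z i ≠ 0 := by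
      by_contra hcon; push Not at hcon; exact hz (funext hcon)
    have : 0 < ∑ i, z i * z i :=
      Finset.sum_pos' (fun i _ => mul_self_nonneg _) ⟨i, Finset.mem_univ _, mul_self_pos.2 hi⟩
    omega
  have hφ : ∀ x ∈ V, φ x + 1 ≤ φ (x + z) := by
    intro x hx
    apply Finset.card_lt_card
    refine ⟨fun y hy => ?_, fun hsub => ?_⟩
    · simp only [Finset.mem_filter] at hy ⊢
      exact ⟨hy.1, hy.2.trans (hL x)⟩
    · have := hsub (Finset.mem_filter.2 ⟨hx, hL x⟩)
      simp at this
  have hφle : ∀ x, φ x ≤ V.card := fun x => Finset.card_filter_le _ _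
  let M : ℕ := R ^ (V.card + 1) + 1
  have hRM : ∀ k, k ≤ V.card + 1 → R ^ k + 1 ≤ M := fun k hk =>
    Nat.add_le_add_right (Nat.pow_le_pow_right hR1 hk) 1
  refine ⟨fun x => if x ∈ V then ((M - R ^ φ x : ℕ) : ℝ≥0∞) else 0, M, ?_, ?_, ?_⟩
  · intro x hx
    have := hRM (φ x) ((hφle x).trans (Nat.le_succ _))
    beta_reduce
    rw [if_pos hx]
    have : 1 ≤ M - R ^ φ x := by omega
    exact_mod_cast this
  · intro x hx
    beta_reduce
    rw [if_pos hx]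
    exact_mod_cast Nat.sub_le _ _
  · intro x hx
    simp only [if_pos hx]
    set S := ∑' i, instrWeight step lam i *
      (if nxt x i ∈ V then ((M - R ^ φ (nxt x i) : ℕ) : ℝ≥0∞) else 0) with hS
    have key : S + p * (R ^ (φ x + 1) : ℕ) ≤ M := by
      have e1 : p * ((R ^ (φ x + 1) : ℕ) : ℝ≥0∞) = ∑' i, instrWeight step lam i *
          (if i = some z then ((R ^ (φ x + 1) : ℕ) : ℝ≥0∞) else 0) := by
        rw [tsum_eq_single (some z)]
        · simp [hp]
        · intro i hi; simp [hi]
      rw [e1, hS, ← ENNReal.tsum_add]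
      calc _ ≤ ∑' i, instrWeight step lam i * (M : ℝ≥0∞) := by
            refine ENNReal.tsum_le_tsum fun i => ?_
            rw [← mul_add]
            gcongr
            by_cases hi : i = some z
            · subst hi
              have hn : nxt x (some z) = x + z := rfl
              rw [if_pos (rfl : (some z : Instr d) = some z), hn]
              have a1 := hφ x hx
              have a2 : R ^ (φ x + 1) ≤ R ^ φ (x + z) := Nat.pow_le_pow_right hR1 a1
              have a3 := hRM (φ (x + z)) ((hφle _).trans (Nat.le_succ _))
              split_ifs
              · have : M - R ^ φ (x + z) + R ^ (φ x + 1) ≤ M := by omega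
                exact_mod_cast this
              · rw [zero_add]
                have : R ^ (φ x + 1) ≤ M := by omega
                exact_mod_cast this
            · simp only [hi, if_false, add_zero]
              split_ifs
              · exact_mod_cast Nat.sub_le _ _
              · exact zero_le
        _ = M := by rw [ENNReal.tsum_mul_right, tsum_weight h0 h1 hlam, one_mul]
    have a3 := hRM (φ x) ((hφle _).trans (Nat.le_succ _))
    have a4 : (M : ℝ≥0∞) = ((M - R ^ φ x : ℕ) : ℝ≥0∞) + ((R ^ φ x : ℕ) : ℝ≥0∞) := by
      rw [← Nat.cast_add]; congr 1; omega
    have a5 : ((R ^ φ x : ℕ) : ℝ≥0∞) + ((R ^ φ x : ℕ) : ℝ≥0∞) ≤ p * (R ^ (φ x + 1) : ℕ) := by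
      calc _ = 2 * ((R ^ φ x : ℕ) : ℝ≥0∞) := by rw [two_mul]
        _ ≤ p * R * ((R ^ φ x : ℕ) : ℝ≥0∞) := by gcongr
        _ = _ := by push_cast; ring
    have a6 : S + (R ^ φ x : ℕ) + (R ^ φ x : ℕ) ≤ ((M - R ^ φ x : ℕ) : ℝ≥0∞) + (R ^ φ x : ℕ) := by
      rw [← a4, add_assoc]
      exact (add_le_add le_rfl a5).trans key
    have a7 := (ENNReal.add_le_add_iff_right (ENNReal.natCast_ne_top _)).1 a6
    refine le_trans (add_le_add le_rfl ?_) a7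
    exact_mod_cast Nat.one_le_pow _ _ hR1

section main

variable {step : Site d → ℝ} {lam : ℝ} {μ : Measure (Stacks d)} {V : Finset (Site d)}

/-- Comparison for functionals of the stacks. -/
lemma functional (h0 : ∀ z, 0 ≤ step z) (h1 : HasSum step 1) (hlam : 0 < lam)
    (hμ : IsStackLaw d step lam μ) {z : Site d} (hz : z ≠ 0) (hsz : step z ≠ 0)
    (Ψ : (Site d → ℤ) → Stacks d → ℝ≥0∞) (hΨ : ∀ ζ, Measurable (Ψ ζ))
    (hcongr : ∀ ζ ζ' I, (∀ x ∈ V, ζ x = ζ' x) → Ψ ζ I = Ψ ζ' I)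
    (r : Site d → Instr d → ℝ≥0∞) (H : Site d → ℝ≥0∞)
    (hH : ∀ x ∈ V, ∑' i, instrWeight step lam i * (r x i + H (nxt x i)) ≤ H x)
    (M : ℝ≥0∞) (hM : M ≠ ⊤) (hΨM : ∀ ζ I, Ψ ζ I ≤ M) (ζ : Site d → ℤ)
    (hsh : ∀ x ∈ V, ∀ I, Ψ (ζ + del x) I ≤ r x (I (x, 0)) + Ψ (ζ + del (nxt x (I (x, 0)))) (sh x I))
    (x : Site d) :
    ∫⁻ I, Ψ (ζ + del x) I ∂μ ≤ ∫⁻ I, Ψ ζ I ∂μ + H x := by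
  have := hμ.1
  obtain ⟨h, C, hh1, hhC, hh⟩ := exists_h V h0 h1 hlam hz hsz
  refine comparison V (instrWeight step lam) (tsum_weight h0 h1 hlam) r
    (fun x => ∫⁻ I, Ψ (ζ + del x) I ∂μ) H h _ M C hM ?_ ?_ ?_ hH hh1 hhC hh x
  · intro x
    calc ∫⁻ I, Ψ (ζ + del x) I ∂μ ≤ ∫⁻ _, M ∂μ := lintegral_mono fun I => hΨM _ I
      _ = M := by simp
  · intro x hx
    refine lintegral_congr fun I => hcongr _ _ _ fun y hy => ?_
    have : x ≠ y := fun h => hx (h ▸ hy)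
    simp [del, this]
  · intro x hx
    calc ∫⁻ I, Ψ (ζ + del x) I ∂μ
        ≤ ∫⁻ I, (fun i I => r x i + Ψ (ζ + del (nxt x i)) I) (I (x, 0)) (sh x I) ∂μ :=
          lintegral_mono fun I => hsh x hx I
      _ = ∑' i, instrWeight step lam i * ∫⁻ I, (r x i + Ψ (ζ + del (nxt x i)) I) ∂μ :=
          lintegral_shift hμ x (fun i I => r x i + Ψ (ζ + del (nxt x i)) I)
            (fun i => measurable_const.add (hΨ _))
      _ = _ := by
          congr 1; funext i
          rw [lintegral_add_left measurable_const]; simp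

lemma X_fin (h0 : ∀ z, 0 ≤ step z) (h1 : HasSum step 1) (hlam : 0 < lam)
    (hμ : IsStackLaw d step lam μ) {z : Site d} (hz : z ≠ 0) (hsz : step z ≠ 0)
    (hV : (0 : Site d) ∈ V) (N : ℕ) : ∀ ζ : Site d → ℤ, ∑ x ∈ V, (ζ x).toNat ≤ N →
    ∫⁻ I, (if X V ζ I = ⊤ then 1 else 0) ∂μ = 0 := by
  have base : ∀ ζ : Site d → ℤ, (∀ x ∈ V, ζ x ≤ 0) →
      ∫⁻ I, (if X V ζ I = ⊤ then 1 else 0) ∂μ = 0 := by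
    intro ζ hζ
    have : ∀ I, X V ζ I ≠ ⊤ := by
      intro I
      have hst : Stab V I ζ (fun _ => 0) := by
        intro x hx
        left
        simpa [cnt] using hζ x hx
      exact ne_top_of_le_ne_top (by simp) (X_le hV hst)
    simp [this]
  induction N with
  | zero =>
    intro ζ hζ
    refine base ζ fun x hx => ?_
    have := (Finset.single_le_sum (f := fun x => (ζ x).toNat) (fun _ _ => Nat.zero_le _) hx).trans hζ
    have h2 : (ζ x).toNat ≤ 0 := this
    omega
  | succ N ih =>
    intro ζ hζ
    by_cases hall : ∀ x ∈ V, ζ x ≤ 0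
    · exact base ζ hall
    push Not at hall
    obtain ⟨x, hx, hx1⟩ := hall
    have hlt : ∑ y ∈ V, ((ζ - del x) y).toNat < ∑ y ∈ V, (ζ y).toNat := by
      refine Finset.sum_lt_sum (fun y _ => ?_) ⟨x, hx, ?_⟩
      · simp only [Pi.sub_apply, del]; split_ifs <;> omega
      · simp only [Pi.sub_apply, del, if_true]; omega
    have hc := ih (ζ - del x) (by omega)
    have := functional (V := V) h0 h1 hlam hμ hz hsz
      (fun ζ I => if X V ζ I = ⊤ then 1 else 0)
      (fun ζ => Measurable.ite ((measurable_X V ζ) (measurableSet_singleton ⊤)) measurable_const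
        measurable_const)
      (fun ζ ζ' I h => by simp only [X_congr h])
      (fun _ _ => 0) (fun _ => 0) (by simp) 1 (by simp)
      (fun ζ I => by split_ifs <;> simp) (ζ - del x) (by
        intro y hy I
        have hX := X_shift hV I (ζ - del x) hy
        by_cases ht : X V (ζ - del x + del (nxt y (I (y, 0)))) (sh y I) = ⊤
        · simp only [ht, if_true, zero_add]
          split_ifs <;> simp
        · have : X V (ζ - del x + del y) I ≠ ⊤ :=
            ne_top_of_le_ne_top (ENNReal.add_ne_top.2 ⟨by simp, ht⟩) hX
          simp [this]) x
    rw [sub_add_cancel, hc] at this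
    simpa using this

lemma X_ae (h0 : ∀ z, 0 ≤ step z) (h1 : HasSum step 1) (hlam : 0 < lam)
    (hμ : IsStackLaw d step lam μ) {z : Site d} (hz : z ≠ 0) (hsz : step z ≠ 0)
    (hV : (0 : Site d) ∈ V) (ζ : Site d → ℤ) : ∀ᵐ I ∂μ, X V ζ I ≠ ⊤ := by
  have hX := X_fin h0 h1 hlam hμ hz hsz hV _ ζ le_rfl
  have hmeas : Measurable (fun I => if X V ζ I = ⊤ then (1 : ℝ≥0∞) else 0) :=
    Measurable.ite ((measurable_X V _) (measurableSet_singleton ⊤)) measurable_const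
      measurable_const
  have h3 := (lintegral_eq_zero_iff hmeas).1 hX
  filter_upwards [h3] with I hI
  intro h
  simp [h] at hI

end main

end
end ARW

open MeasureTheory ENNReal Filter Topology ARW

theorem arw_expected_chances_le_green (d : ℕ) (step : Site d → ℝ) (h0 : ∀ z, 0 ≤ step z) (h1 : HasSum step 1)
    (lam : ℝ) (hlam : 0 < lam) (V : Finset (Site d)) (hV : (0 : Site d) ∈ V)
    (η : Site d → ℕ) :
    (∫⁻ I, ((chances V I η : ℕ∞) : ℝ≥0∞) ∂(stackLaw d step lam)) ≤ greenE step := by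
  classical
  by_cases hex : ∃ μ, IsStackLaw d step lam μ
  swap
  · simp [stackLaw, hex]
  have hμ : IsStackLaw d step lam (stackLaw d step lam) := by
    unfold stackLaw; rw [dif_pos hex]; exact hex.choose_spec
  generalize stackLaw d step lam = μ at hμ
  have := hμ.1
  by_cases hnz : ∀ z, z ≠ 0 → step z = 0
  · rw [green_top h0 h1 hnz]; exact le_top
  push Not at hnz
  obtain ⟨z, hz, hsz⟩ := hnz
  have hfin : ∀ᵐ I ∂μ, X V (zet η) I ≠ ⊤ :=
    X_ae h0 h1 hlam hμ hz hsz hV (zet η)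
  set Xs := X V (zet η) with hXs
  set Xw := X V (zet η - del 0) with hXw
  have hms : Measurable Xs := measurable_X _ _
  have hmw : Measurable Xw := measurable_X _ _
  have hch : ∀ᵐ I ∂μ, ((chances V I η : ℕ∞) : ℝ≥0∞) + Xw I ≤ Xs I := by
    filter_upwards [hfin] with I hI
    obtain ⟨m, hm, hJ⟩ := exists_of_X_ne_top hI
    obtain ⟨m₀, hm₀, c, hc, hle⟩ := chances_le hV ⟨m, hm⟩
    rw [hXs, hJ, hc]
    refine (add_le_add le_rfl (X_le hV hm₀)).trans ?_
    have := hle m hm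
    simp only [ENat.toENNReal_coe]
    exact_mod_cast this
  have htr : ∀ M : ℕ, ∫⁻ I, min (Xs I) M ∂μ ≤ ∫⁻ I, min (Xw I) M ∂μ + greenE step := by
    intro M
    have := functional (V := V) h0 h1 hlam hμ hz hsz (fun ζ I => min (X V ζ I) M)
      (fun ζ => (measurable_X V ζ).min measurable_const)
      (fun ζ ζ' I h => by simp only [X_congr h])
      (fun x i => (rew x i : ℝ≥0∞)) (gr step) (fun x _ => gr_super h0 h1 hlam x) M (by simp)
      (fun ζ I => min_le_right _ _) (zet η - del 0) (by
        intro y hy I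
        have hX := X_shift hV I (zet η - del 0) hy
        refine (min_le_min_right _ hX).trans ?_
        rw [← min_add_add_left]
        exact min_le_min_left _ le_add_self) 0
    rw [sub_add_cancel, gr_zero h0 h1] at this
    exact this
  have hD : ∀ M : ℕ, ∫⁻ I, Set.indicator {I | Xs I ≤ M} (fun I => Xs I - Xw I) I ∂μ
      ≤ greenE step := by
    intro M
    have hle : ∫⁻ I, Set.indicator {I | Xs I ≤ M} (fun I => Xs I - Xw I) I ∂μ
        + ∫⁻ I, min (Xw I) M ∂μ ≤ ∫⁻ I, min (Xs I) M ∂μ := by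
      refine (le_lintegral_add _ _).trans (lintegral_mono_ae ?_)
      filter_upwards [hch] with I hI
      have hws : Xw I ≤ Xs I := le_add_self.trans hI
      by_cases hM : Xs I ≤ M
      · simp only [Set.indicator, Set.mem_ofPred_eq, hM, if_true]
        rw [min_eq_left hM, min_eq_left (hws.trans hM), tsub_add_cancel_of_le hws]
      · simp only [Set.indicator, Set.mem_ofPred_eq, hM, if_false, zero_add]
        exact min_le_min_right _ hws
    have h2 := hle.trans (htr M)
    rw [add_comm] at h2
    refine (ENNReal.add_le_add_iff_left ?_).1 h2
    refine ne_top_of_le_ne_top (b := (M : ℝ≥0∞)) (by simp) ?_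
    calc ∫⁻ I, min (Xw I) M ∂μ ≤ ∫⁻ _, (M : ℝ≥0∞) ∂μ := lintegral_mono fun I => min_le_right _ _
      _ = M := by simp
  calc ∫⁻ I, ((chances V I η : ℕ∞) : ℝ≥0∞) ∂μ
      ≤ ∫⁻ I, ⨆ M : ℕ, Set.indicator {I | Xs I ≤ M} (fun I => Xs I - Xw I) I ∂μ := by
        refine lintegral_mono_ae ?_
        filter_upwards [hch, hfin] with I hI hf
        obtain ⟨M, hM⟩ := ENNReal.exists_nat_gt hf
        refine le_trans ?_ (le_iSup _ M)
        simp only [Set.indicator, Set.mem_ofPred_eq, hM.le, if_true]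
        have hw : Xw I ≠ ⊤ := ne_top_of_le_ne_top hf (le_add_self.trans hI)
        exact (ENNReal.cancel_of_ne hw).le_tsub_of_add_le_right hI
    _ = ⨆ M : ℕ, ∫⁻ I, Set.indicator {I | Xs I ≤ M} (fun I => Xs I - Xw I) I ∂μ := by
        refine lintegral_iSup ?_ ?_
        · intro M
          exact (hms.sub hmw).indicator (measurableSet_le hms measurable_const)
        · intro a b hab I
          refine Set.indicator_le_indicator_of_subset ?_ (fun _ => zero_le) I
          intro I hI
          have hI2 : Xs I ≤ (a : ℝ≥0∞) := hI
          have hab2 : (a : ℝ≥0∞) ≤ (b : ℝ≥0∞) := by exact_mod_cast hab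
          exact hI2.trans hab2
    _ ≤ greenE step := iSup_le hD
end

section
/- Consider activated random walk on ℤ with simple symmetric nearest-neighbor jumps. There exist a constant C₁ > 0 and λ₀ > 1 such that for all λ ≥ λ₀, all finite V ⊂ ℤ with V ⊇ B_λ, and all all-active configurations η filling B_λ, P(0 ∉ Stab_V η) ≤ C₁ · λ^{−2} · log λ, where B_λ = {x ∈ ℤ : |x| ≤ λ}. -/
/-!
Common framework for the activated random walk (ARW) model on `ℤ^d`,
via the site-wise (Diaconis–Fulton) representation.
-/

open MeasureTheory ENNReal Filter

namespace ARW
namespace Pf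

/-- Toppling with a prescribed instruction: effect of the instruction at the toppled site. -/
def locop {d : ℕ} : Instr d → SiteState → SiteState
  | none, σ => if numActive σ = 1 then .sleeping else σ
  | some _, σ => .active (numActive σ - 1)

/-- The instruction `i` at `x` sends a particle to `w`. -/
def Hits {d : ℕ} (V : Finset (Site d)) (i : Instr d) (x w : Site d) : Prop :=
  ∃ z, i = some z ∧ x + z = w ∧ w ∈ V

open scoped Classical in
/-- Toppling `x` with a prescribed instruction `i`. -/
noncomputable def toppleI {d : ℕ} (V : Finset (Site d)) (i : Instr d) (x : Site d)
    (s : State d) : State d :=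
  (fun w => if Hits V i x w then addParticle (if w = x then locop i (s.1 w) else s.1 w)
    else (if w = x then locop i (s.1 w) else s.1 w), Function.update s.2 x (s.2 x + 1))

theorem topple_eq {d : ℕ} (V : Finset (Site d)) (I : Stacks d) (x : Site d) (s : State d) :
    topple V I x s = toppleI V (I (x, s.2 x)) x s := by
  classical
  unfold topple toppleI
  refine Prod.ext ?_ ?_
  · funext w
    cases hi : I (x, s.2 x) with
    | none =>
      have : ¬ Hits V (none : Instr d) x w := by rintro ⟨z, hz, _⟩; cases hz
      simp only [this, if_false, hi]
      by_cases hw : w = x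
      · subst hw
        simp only [locop, if_true]
        split_ifs <;> simp
      · simp only [hw, if_false]
        split_ifs <;> simp [Function.update_of_ne hw]
    | some z =>
      have hH : Hits V (some z : Instr d) x w ↔ x + z = w ∧ w ∈ V := by
        constructor
        · rintro ⟨z', hz, h⟩
          cases hz; exact h
        · intro h; exact ⟨z, rfl, h⟩
      simp only [hH, hi]
      by_cases hV : x + z ∈ V
      · simp only [hV, if_true]
        by_cases h1 : x + z = w
        · subst h1
          simp only [hV, and_self, if_true, Function.update_self]
          congr 1
          by_cases h2 : x + z = x
          · simp [h2, locop]
          · simp [h2, Function.update_of_ne]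
        · simp only [h1, false_and, if_false]
          rw [Function.update_of_ne (Ne.symm h1)]
          by_cases h2 : w = x
          · subst h2; simp [locop]
          · simp [h2, Function.update_of_ne]
      · have : ¬ (x + z = w ∧ w ∈ V) := by rintro ⟨rfl, h⟩; exact hV h
        simp only [hV, if_false, this]
        by_cases h2 : w = x
        · subst h2; simp [locop]
        · simp [h2, Function.update_of_ne]
  · rfl

theorem locop_add {d : ℕ} (i : Instr d) (σ : SiteState) (h : 1 ≤ numActive σ) :
    locop i (addParticle σ) = addParticle (locop i σ) := by
  cases σ with
  | sleeping => simp [numActive] at h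
  | active n =>
    simp only [numActive] at h
    cases i with
    | none =>
      by_cases h1 : n = 1
      · subst h1; simp [locop, addParticle, numActive]
      · have : n ≠ 0 := by omega
        simp [locop, addParticle, numActive, h1, this]
    | some z =>
      simp only [locop, addParticle, numActive]
      congr 1; omega

theorem toppleI_comm {d : ℕ} (V : Finset (Site d)) (i j : Instr d) (x y : Site d)
    (s : State d) (hxy : x ≠ y) (hx : 1 ≤ numActive (s.1 x)) (hy : 1 ≤ numActive (s.1 y)) :
    toppleI V i x (toppleI V j y s) = toppleI V j y (toppleI V i x s) := by
  classical
  unfold toppleI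
  refine Prod.ext ?_ ?_
  · funext w
    by_cases h1 : w = x
    · subst h1
      simp only [hxy, if_true, if_false]
      split_ifs <;> simp [locop_add _ _ hx]
    · by_cases h2 : w = y
      · subst h2
        simp only [h1, if_true, if_false]
        split_ifs <;> simp [locop_add _ _ hy]
      · simp only [h1, h2, if_false]
        split_ifs <;> rfl
  · simp only [Function.update_of_ne hxy, Function.update_of_ne hxy.symm]
    exact Function.update_comm hxy.symm _ _ _

theorem numActive_add (σ : SiteState) : numActive σ + 1 ≤ numActive (addParticle σ) := by
  cases σ <;> simp [numActive, addParticle]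

theorem numActive_mono {d : ℕ} (V : Finset (Site d)) (i : Instr d) (x w : Site d)
    (s : State d) (h : w ≠ x) : numActive (s.1 w) ≤ numActive ((toppleI V i x s).1 w) := by
  classical
  unfold toppleI
  simp only [h, if_false]
  split_ifs
  · have := numActive_add (s.1 w); omega
  · exact le_rfl

theorem numActive_self {d : ℕ} (V : Finset (Site d)) (i : Instr d) (x : Site d)
    (s : State d) (h : 2 ≤ numActive (s.1 x)) : 1 ≤ numActive ((toppleI V i x s).1 x) := by
  classical
  have h1 : 1 ≤ numActive (locop i (s.1 x)) := by
    cases i with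
    | none => simp only [locop]; rw [if_neg (by omega)]; omega
    | some z => change 1 ≤ numActive (s.1 x) - 1; omega
  unfold toppleI
  simp only [if_true]
  split_ifs
  · have := numActive_add (locop i (s.1 x)); omega
  · exact h1

/-- Legality with thresholds. -/
def GLegal {d : ℕ} (t : Site d → ℕ) (V : Finset (Site d)) (I : Stacks d) :
    State d → List (Site d) → Prop
  | _, [] => True
  | s, x :: l => x ∈ V ∧ t x ≤ numActive (s.1 x) ∧ GLegal t V I (topple V I x s) l

theorem legal_g {d : ℕ} (V : Finset (Site d)) (I : Stacks d) (l : List (Site d)) :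
    ∀ s, Legal V I s l → GLegal (fun _ => 1) V I s l := by
  induction l with
  | nil => intro s _; trivial
  | cons x l ih => intro s h; exact ⟨h.1, h.2.1, ih _ h.2.2⟩

/-- The stabilization (with thresholds `t`) of `s` takes at most `n` topplings and ends in a
state satisfying `Q`. -/
def Ev {d : ℕ} (t : Site d → ℕ) (V : Finset (Site d)) (Q : Stacks d → State d → Prop)
    (I : Stacks d) (s : State d) (n : ℕ) : Prop :=
  ∃ l : List (Site d), l.length ≤ n ∧ GLegal t V I s l ∧
    (∀ x ∈ V, numActive ((run V I s l).1 x) < t x) ∧ Q I (run V I s l)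

theorem exchange {d : ℕ} (t : Site d → ℕ) (ht : ∀ x, 1 ≤ t x) (V : Finset (Site d))
    (I : Stacks d) (x : Site d) (hxV : x ∈ V) (l : List (Site d)) :
    ∀ s, t x ≤ numActive (s.1 x) → GLegal t V I s l →
      (∀ y ∈ V, numActive ((run V I s l).1 y) < t y) →
      ∃ l', l'.length + 1 = l.length ∧ GLegal t V I (topple V I x s) l' ∧
        run V I (topple V I x s) l' = run V I s l := by
  induction l with
  | nil =>
    intro s hx _ hst
    have := hst x hxV
    simp only [run] at this
    omega
  | cons y l ih =>
    intro s hx hl hst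
    by_cases hxy : x = y
    · subst hxy
      exact ⟨l, rfl, hl.2.2, rfl⟩
    · obtain ⟨l', h1, h2, h3⟩ := ih (topple V I y s)
        (by rw [topple_eq]; exact hx.trans (numActive_mono V _ y x s hxy)) hl.2.2 hst
      have hc : topple V I x (topple V I y s) = topple V I y (topple V I x s) := by
        have e1 : (topple V I y s).2 x = s.2 x := by
          simp [topple, Function.update_of_ne hxy]
        have e2 : (topple V I x s).2 y = s.2 y := by
          simp [topple, Function.update_of_ne (Ne.symm hxy)]
        rw [topple_eq V I x (topple V I y s), topple_eq V I y (topple V I x s), e1, e2,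
          topple_eq V I y s, topple_eq V I x s]
        exact toppleI_comm V _ _ x y s hxy ((ht x).trans hx) ((ht y).trans hl.2.1)
      refine ⟨y :: l', by simp [h1], ⟨hl.1, ?_, ?_⟩, ?_⟩
      · rw [topple_eq]
        exact hl.2.1.trans (numActive_mono V _ x y s (Ne.symm hxy))
      · rw [← hc]; exact h2
      · simp only [run]
        rw [← hc]; exact h3

theorem Ev.step {d : ℕ} {t : Site d → ℕ} (ht : ∀ x, 1 ≤ t x) {V : Finset (Site d)}
    {Q : Stacks d → State d → Prop} {I : Stacks d} {s : State d} {n : ℕ}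
    (h : Ev t V Q I s n) {x : Site d} (hxV : x ∈ V) (hx : t x ≤ numActive (s.1 x)) :
    ∃ n', n = n' + 1 ∧ Ev t V Q I (toppleI V (I (x, s.2 x)) x s) n' := by
  obtain ⟨l, h1, h2, h3, h4⟩ := h
  obtain ⟨l', g1, g2, g3⟩ := exchange t ht V I x hxV l s hx h2 h3
  refine ⟨n - 1, by omega, l', by omega, ?_, ?_, ?_⟩
  · rw [← topple_eq]; exact g2
  · rw [← topple_eq, g3]; exact h3
  · rw [← topple_eq, g3]; exact h4

theorem Ev.stable {d : ℕ} {t : Site d → ℕ} {V : Finset (Site d)}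
    {Q : Stacks d → State d → Prop} {I : Stacks d} {s : State d} {n : ℕ}
    (h : Ev t V Q I s n) (hs : ∀ x ∈ V, numActive (s.1 x) < t x) : Q I s := by
  obtain ⟨l, h1, h2, h3, h4⟩ := h
  cases l with
  | nil => exact h4
  | cons x l =>
    have := hs x h2.1
    have := h2.2.1
    omega

theorem Ev.mono {d : ℕ} {t : Site d → ℕ} {V : Finset (Site d)}
    {Q : Stacks d → State d → Prop} {I : Stacks d} {s : State d} {n m : ℕ} (hnm : n ≤ m)
    (h : Ev t V Q I s n) : Ev t V Q I s m := by
  obtain ⟨l, h1, h2⟩ := h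
  exact ⟨l, h1.trans hnm, h2⟩

/-! ### Conditional probability bounds -/

/-- `E` has conditional probability at most `p` given any information on the instructions
below the odometer `m`. -/
def Bnd {d : ℕ} (μ : Measure (Stacks d)) (W : Instr d → ℝ≥0∞) (m : Site d → ℕ)
    (E : Set (Stacks d)) (p : ℝ≥0∞) : Prop :=
  ∀ (F : Finset (Site d × ℕ)) (g : Site d × ℕ → Instr d), (∀ i ∈ F, i.2 < m i.1) →
    μ ({I | ∀ i ∈ F, I i = g i} ∩ E) ≤ (∏ i ∈ F, W (g i)) * p

theorem Bnd.mono {d : ℕ} {μ : Measure (Stacks d)} {W : Instr d → ℝ≥0∞} {m : Site d → ℕ}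
    {E E' : Set (Stacks d)} {p p' : ℝ≥0∞} (h : Bnd μ W m E p) (hE : E' ⊆ E) (hp : p ≤ p') :
    Bnd μ W m E' p' := by
  intro F g hF
  calc _ ≤ μ ({I | ∀ i ∈ F, I i = g i} ∩ E) := by gcongr
    _ ≤ _ := h F g hF
    _ ≤ _ := by gcongr

theorem Bnd.empty {d : ℕ} {μ : Measure (Stacks d)} {W : Instr d → ℝ≥0∞} {m : Site d → ℕ}
    {E : Set (Stacks d)} {p : ℝ≥0∞} (hE : ∀ I, I ∉ E) : Bnd μ W m E p := by
  intro F g hF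
  rw [Set.eq_empty_of_forall_notMem hE]
  simp

theorem Bnd.one {d : ℕ} {μ : Measure (Stacks d)} {W : Instr d → ℝ≥0∞} {m : Site d → ℕ}
    {E : Set (Stacks d)} {p : ℝ≥0∞}
    (hμ : ∀ (F : Finset (Site d × ℕ)) (g : Site d × ℕ → Instr d),
      μ {I | ∀ i ∈ F, I i = g i} = ∏ i ∈ F, W (g i)) (hp : 1 ≤ p) : Bnd μ W m E p := by
  intro F g hF
  calc _ ≤ μ {I | ∀ i ∈ F, I i = g i} := measure_mono Set.inter_subset_left
    _ = (∏ i ∈ F, W (g i)) * 1 := by rw [hμ, mul_one]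
    _ ≤ _ := by gcongr

theorem Bnd.iUnion {d : ℕ} {μ : Measure (Stacks d)} {W : Instr d → ℝ≥0∞} {m : Site d → ℕ}
    {E : ℕ → Set (Stacks d)} {p : ℝ≥0∞} (hE : Monotone E) (h : ∀ n, Bnd μ W m (E n) p) :
    Bnd μ W m (⋃ n, E n) p := by
  intro F g hF
  rw [Set.inter_iUnion, Monotone.measure_iUnion]
  · exact iSup_le fun n => h n F g hF
  · intro a b hab
    exact Set.inter_subset_inter_right _ (hE hab)

/-- one-dimensional sites -/
def pt (z : ℤ) : Site 1 := fun _ => z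

theorem pt_eta (x : Site 1) : pt (x 0) = x := by
  funext i; fin_cases i; rfl

theorem pt_add (a b : ℤ) : pt a + pt b = pt (a + b) := rfl

theorem pt_zero : pt 0 = 0 := rfl

theorem pt_inj {a b : ℤ} : pt a = pt b ↔ a = b :=
  ⟨fun h => congrFun h 0, fun h => by rw [h]⟩

theorem Bnd.split {μ : Measure (Stacks 1)} {W : Instr 1 → ℝ≥0∞} {m : Site 1 → ℕ}
    {E : Set (Stacks 1)} {x : Site 1} {a b c : ℝ≥0∞}
    (hμ : ∀ (F : Finset (Site 1 × ℕ)) (g : Site 1 × ℕ → Instr 1),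
      μ {I | ∀ i ∈ F, I i = g i} = ∏ i ∈ F, W (g i))
    (hW : ∀ i, i ≠ none → i ≠ some (pt 1) → i ≠ some (pt (-1)) → W i = 0)
    (ha : Bnd μ W (Function.update m x (m x + 1)) {I | I ∈ E ∧ I (x, m x) = none} a)
    (hb : Bnd μ W (Function.update m x (m x + 1)) {I | I ∈ E ∧ I (x, m x) = some (pt 1)} b)
    (hc : Bnd μ W (Function.update m x (m x + 1)) {I | I ∈ E ∧ I (x, m x) = some (pt (-1))} c) :
    Bnd μ W m E (W none * a + W (some (pt 1)) * b + W (some (pt (-1))) * c) := by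
  classical
  intro F g hF
  set P : Site 1 × ℕ := (x, m x) with hP
  have hPF : P ∉ F := fun h => by have := hF _ h; simp [hP] at this
  have key : ∀ (i : Instr 1) (q : ℝ≥0∞),
      Bnd μ W (Function.update m x (m x + 1)) {I | I ∈ E ∧ I P = i} q →
      μ ({I | ∀ j ∈ F, I j = g j} ∩ {I | I ∈ E ∧ I P = i}) ≤ (∏ j ∈ F, W (g j)) * (W i * q) := by
    intro i q h
    have h2 := h (insert P F) (Function.update g P i) (by
      intro j hj
      rcases Finset.mem_insert.1 hj with rfl | hj
      · simp [hP]
      · have := hF j hj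
        by_cases hx : j.1 = x
        · rw [hx] at this ⊢; simp; omega
        · rwa [Function.update_of_ne hx])
    rw [Finset.prod_insert hPF] at h2
    have e : ∏ j ∈ F, W (Function.update g P i j) = ∏ j ∈ F, W (g j) := by
      refine Finset.prod_congr rfl fun j hj => ?_
      rw [Function.update_of_ne (fun h : j = P => hPF (h ▸ hj))]
    rw [e, Function.update_self] at h2
    calc _ ≤ _ := measure_mono ?_
      _ ≤ _ := h2
      _ = _ := by ring
    rintro I ⟨h3, h4⟩
    refine ⟨fun j hj => ?_, h4⟩
    rcases Finset.mem_insert.1 hj with rfl | hj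
    · rw [Function.update_self]; exact h4.2
    · rw [Function.update_of_ne (fun h : j = P => hPF (h ▸ hj))]; exact h3 j hj
  have null : μ {I : Stacks 1 | I P ≠ none ∧ I P ≠ some (pt 1) ∧ I P ≠ some (pt (-1))} = 0 := by
    have : {I : Stacks 1 | I P ≠ none ∧ I P ≠ some (pt 1) ∧ I P ≠ some (pt (-1))} =
        ⋃ i : {i : Instr 1 // i ≠ none ∧ i ≠ some (pt 1) ∧ i ≠ some (pt (-1))},
          {I : Stacks 1 | I P = i.1} := by
      ext I; simp
    rw [this]
    refine measure_iUnion_null fun i => ?_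
    have h := hμ {P} (fun _ => i.1)
    simp only [Finset.mem_singleton, forall_eq, Finset.prod_singleton] at h
    rw [h]
    exact hW _ i.2.1 i.2.2.1 i.2.2.2
  set C : Set (Stacks 1) := {I | ∀ j ∈ F, I j = g j}
  have hsub : C ∩ E ⊆ ((C ∩ {I | I ∈ E ∧ I P = none}) ∪ (C ∩ {I | I ∈ E ∧ I P = some (pt 1)})
      ∪ (C ∩ {I | I ∈ E ∧ I P = some (pt (-1))})) ∪
      {I : Stacks 1 | I P ≠ none ∧ I P ≠ some (pt 1) ∧ I P ≠ some (pt (-1))} := by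
    rintro I ⟨h1, h2⟩
    by_cases e1 : I P = none
    · exact Or.inl (Or.inl (Or.inl ⟨h1, h2, e1⟩))
    by_cases e2 : I P = some (pt 1)
    · exact Or.inl (Or.inl (Or.inr ⟨h1, h2, e2⟩))
    by_cases e3 : I P = some (pt (-1))
    · exact Or.inl (Or.inr ⟨h1, h2, e3⟩)
    exact Or.inr ⟨e1, e2, e3⟩
  calc μ (C ∩ E) ≤ _ := measure_mono hsub
    _ ≤ μ (C ∩ {I | I ∈ E ∧ I P = none}) + μ (C ∩ {I | I ∈ E ∧ I P = some (pt 1)})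
      + μ (C ∩ {I | I ∈ E ∧ I P = some (pt (-1))}) + 0 := by
        refine (measure_union_le _ _).trans ?_
        rw [null]
        gcongr
        refine (measure_union_le _ _).trans ?_
        gcongr
        exact measure_union_le _ _
    _ ≤ (∏ j ∈ F, W (g j)) * (W none * a) + (∏ j ∈ F, W (g j)) * (W (some (pt 1)) * b)
      + (∏ j ∈ F, W (g j)) * (W (some (pt (-1))) * c) + 0 := by
        gcongr
        · exact key _ _ ha
        · exact key _ _ hb
        · exact key _ _ hc
    _ = _ := by ring

/-- The standing assumptions on the law and the weights. -/
structure Law (μ : Measure (Stacks 1)) (W : Instr 1 → ℝ≥0∞) (J : ℝ≥0∞) : Prop where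
  hμ : ∀ (F : Finset (Site 1 × ℕ)) (g : Site 1 × ℕ → Instr 1),
      μ {I | ∀ i ∈ F, I i = g i} = ∏ i ∈ F, W (g i)
  hW : ∀ i, i ≠ none → i ≠ some (pt 1) → i ≠ some (pt (-1)) → W i = 0
  hpm : W (some (pt 1)) = W (some (pt (-1)))
  hJ : W (some (pt 1)) + W (some (pt (-1))) = J
  h1 : W none + J = 1

theorem Law.step {μ : Measure (Stacks 1)} {W : Instr 1 → ℝ≥0∞} {J : ℝ≥0∞} (L : Law μ W J)
    {t : Site 1 → ℕ} (ht : ∀ x, 1 ≤ t x) {V : Finset (Site 1)}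
    {Q : Stacks 1 → State 1 → Prop} {s : State 1} {n : ℕ}
    {x : Site 1} (hxV : x ∈ V) (hx : t x ≤ numActive (s.1 x)) (q : Instr 1 → ℝ≥0∞) {p : ℝ≥0∞}
    (h : ∀ n', n' + 1 = n → ∀ i, (i = none ∨ i = some (pt 1) ∨ i = some (pt (-1))) →
      Bnd μ W (toppleI V i x s).2 {I | Ev t V Q I (toppleI V i x s) n'} (q i))
    (hp : W none * q none + W (some (pt 1)) * q (some (pt 1))
      + W (some (pt (-1))) * q (some (pt (-1))) ≤ p) :
    Bnd μ W s.2 {I | Ev t V Q I s n} p := by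
  rcases n with _ | n
  · refine Bnd.empty fun I hI => ?_
    obtain ⟨n', h, _⟩ := Ev.step ht hI hxV hx
    omega
  have key : ∀ i, (i = none ∨ i = some (pt 1) ∨ i = some (pt (-1))) →
      Bnd μ W (Function.update s.2 x (s.2 x + 1))
        {I | I ∈ {I | Ev t V Q I s (n+1)} ∧ I (x, s.2 x) = i} (q i) := by
    intro i hi
    refine (h n rfl i hi).mono ?_ le_rfl
    rintro I ⟨h1, h2⟩
    obtain ⟨n', h3, h4⟩ := Ev.step ht h1 hxV hx
    obtain rfl : n = n' := by omega
    rw [h2] at h4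
    exact h4
  exact (Bnd.split L.hμ L.hW (key _ (Or.inl rfl)) (key _ (Or.inr (Or.inl rfl)))
    (key _ (Or.inr (Or.inr rfl)))).mono subset_rfl hp

theorem Law.stepConst {μ : Measure (Stacks 1)} {W : Instr 1 → ℝ≥0∞} {J : ℝ≥0∞} (L : Law μ W J)
    {t : Site 1 → ℕ} (ht : ∀ x, 1 ≤ t x) {V : Finset (Site 1)}
    {Q : Stacks 1 → State 1 → Prop} {s : State 1} {n : ℕ}
    {x : Site 1} (hxV : x ∈ V) (hx : t x ≤ numActive (s.1 x)) {p : ℝ≥0∞}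
    (h : ∀ n', n' + 1 = n → ∀ i,
      Bnd μ W (toppleI V i x s).2 {I | Ev t V Q I (toppleI V i x s) n'} p) :
    Bnd μ W s.2 {I | Ev t V Q I s n} p := by
  refine L.step ht hxV hx (fun _ => p) (fun n' hn i _ => h n' hn i) (le_of_eq ?_)
  have : (W none + (W (some (pt 1)) + W (some (pt (-1))))) * p = p := by
    rw [L.hJ, L.h1, one_mul]
  rw [← add_mul, ← add_mul, add_assoc]; exact this

/-- A sleep trial: the sleep instruction is good, a jump has bound `p`. -/
theorem Law.stepTrial {μ : Measure (Stacks 1)} {W : Instr 1 → ℝ≥0∞} {J : ℝ≥0∞} (L : Law μ W J)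
    {t : Site 1 → ℕ} (ht : ∀ x, 1 ≤ t x) {V : Finset (Site 1)}
    {Q : Stacks 1 → State 1 → Prop} {s : State 1} {n : ℕ}
    {x : Site 1} (hxV : x ∈ V) (hx : t x ≤ numActive (s.1 x)) {p : ℝ≥0∞}
    (h0 : ∀ n' I, ¬ Ev t V Q I (toppleI V none x s) n')
    (h : ∀ n', n' + 1 = n → ∀ z, (z = 1 ∨ z = -1) →
      Bnd μ W (toppleI V (some (pt z)) x s).2
        {I | Ev t V Q I (toppleI V (some (pt z)) x s) n'} p) :
    Bnd μ W s.2 {I | Ev t V Q I s n} (J * p) := by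
  refine L.step ht hxV hx (fun i => if i = none then 0 else p) (fun n' hn i hi => ?_)
    (le_of_eq ?_)
  · rcases hi with rfl | rfl | rfl
    · exact Bnd.empty (h0 n')
    · simpa using h n' hn 1 (Or.inl rfl)
    · simpa using h n' hn (-1) (Or.inr rfl)
  · simp [← L.hJ, add_mul]

/-- thresholds of weak stabilization -/
def tw (x : Site 1) : ℕ := if x = 0 then 2 else 1

theorem tw_pos (x : Site 1) : 1 ≤ tw x := by unfold tw; split_ifs <;> omega

/-- the origin does not hold a sleeping particle -/
def Qe (_ : Stacks 1) (s : State 1) : Prop := s.1 0 ≠ .sleeping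

/-- Toppling a lone particle with a sleep instruction. -/
theorem sleep_self {d : ℕ} (V : Finset (Site d)) (x : Site d) (s : State d)
    (h : numActive (s.1 x) = 1) : (toppleI V none x s).1 x = .sleeping := by
  classical
  have : ¬ Hits V (none : Instr d) x x := by rintro ⟨z, hz, _⟩; cases hz
  simp [toppleI, this, locop, h]

theorem sleep_ne {d : ℕ} (V : Finset (Site d)) (x w : Site d) (s : State d)
    (h : w ≠ x) : (toppleI V none x s).1 w = s.1 w := by
  classical
  have : ¬ Hits V (none : Instr d) x w := by rintro ⟨z, hz, _⟩; cases hz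
  simp [toppleI, this, h]

theorem sleep_two {d : ℕ} (V : Finset (Site d)) (x : Site d) (s : State d)
    (h : 2 ≤ numActive (s.1 x)) : (toppleI V none x s).1 x = s.1 x := by
  classical
  have : ¬ Hits V (none : Instr d) x x := by rintro ⟨z, hz, _⟩; cases hz
  have h2 : numActive (s.1 x) ≠ 1 := by omega
  simp [toppleI, this, locop, h2]

theorem jump_target {d : ℕ} (V : Finset (Site d)) (x z : Site d) (s : State d)
    (hV : x + z ∈ V) (hz : x + z ≠ x) :
    (toppleI V (some z) x s).1 (x + z) = addParticle (s.1 (x + z)) := by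
  classical
  have : Hits V (some z : Instr d) x (x + z) := ⟨z, rfl, rfl, hV⟩
  simp only [toppleI, this, if_true, hz, if_false]

/-- occupied -/
def Occ (σ : SiteState) : Prop := σ ≠ .active 0

theorem Occ.add (σ : SiteState) : Occ (addParticle σ) := by
  cases σ <;> simp [Occ, addParticle]

theorem Occ.add_two {σ : SiteState} (h : Occ σ) : 2 ≤ numActive (addParticle σ) := by
  cases σ with
  | sleeping => simp [numActive, addParticle]
  | active n =>
    have : n ≠ 0 := by rintro rfl; exact h rfl
    simp only [numActive, addParticle]; omega

theorem Occ.of_active {σ : SiteState} (h : 1 ≤ numActive σ) : Occ σ := by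
  rintro rfl; simp [numActive] at h

theorem Occ.topple_ne {d : ℕ} (V : Finset (Site d)) (i : Instr d) (x w : Site d)
    (s : State d) (h : w ≠ x) (ho : Occ (s.1 w)) : Occ ((toppleI V i x s).1 w) := by
  classical
  unfold toppleI
  simp only [h, if_false]
  split_ifs
  · exact Occ.add _
  · exact ho

/-- Weakly legal topplings keep the origin occupied by an active particle. -/
theorem weak_inv {V : Finset (Site 1)} {i : Instr 1} {x y : Site 1} {s : State 1}
    (hy : 1 ≤ numActive (s.1 y)) (hx : y = x → 2 ≤ numActive (s.1 x)) :
    1 ≤ numActive ((toppleI V i x s).1 y) := by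
  by_cases h : y = x
  · subst h; exact numActive_self V i y s (hx rfl)
  · exact hy.trans (numActive_mono V i x y s h)

theorem trial_dead {V : Finset (Site 1)} {s : State 1} (h0V : (0 : Site 1) ∈ V)
    (h0 : numActive (s.1 0) = 1) (hs : ∀ x ∈ V, x ≠ 0 → numActive (s.1 x) = 0) (n : ℕ)
    (I : Stacks 1) : ¬ Ev (fun _ => 1) V Qe I (toppleI V none 0 s) n := by
  intro h
  refine h.stable (fun x hx => ?_) (sleep_self V 0 s h0)
  by_cases hx0 : x = 0
  · subst hx0; rw [sleep_self V 0 s h0]; simp [numActive]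
  · rw [sleep_ne V 0 x s hx0, hs x hx hx0]; exact Nat.one_pos

/-- Claim A. -/
theorem Law.claimA {μ : Measure (Stacks 1)} {W : Instr 1 → ℝ≥0∞} {J : ℝ≥0∞} (L : Law μ W J)
    {V : Finset (Site 1)} (h0V : (0 : Site 1) ∈ V) (n : ℕ) :
    ∀ s : State 1, 1 ≤ numActive (s.1 0) →
      Bnd μ W s.2 {I | Ev (fun _ => 1) V Qe I s n} J := by
  induction n with
  | zero =>
    intro s h0
    exact L.stepConst (fun _ => le_rfl) h0V h0 (fun n' hn => by omega)
  | succ n ih =>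
    intro s h0
    by_cases hw : ∃ x ∈ V, tw x ≤ numActive (s.1 x)
    · obtain ⟨x, hxV, hx⟩ := hw
      refine L.stepConst (fun _ => le_rfl) hxV ((tw_pos x).trans hx) fun n' hn i => ?_
      obtain rfl : n' = n := by omega
      refine ih _ (weak_inv h0 ?_)
      rintro rfl
      simpa [tw] using hx
    · push Not at hw
      have h2 := hw 0 h0V
      simp only [tw, if_true] at h2
      rw [← mul_one J]
      refine L.stepTrial (fun _ => le_rfl) h0V h0 (trial_dead h0V (by omega) ?_) ?_
      · intro x hx hx0
        have := hw x hx
        simp only [tw, hx0, if_false] at this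
        omega
      · intro n' hn z hz
        exact Bnd.one L.hμ le_rfl

/-- The walk. -/
theorem Law.claimW {μ : Measure (Stacks 1)} {W : Instr 1 → ℝ≥0∞} {J : ℝ≥0∞} (L : Law μ W J)
    {V : Finset (Site 1)} (h0V : (0 : Site 1) ∈ V) (K : ℕ) (hK : 1 ≤ K)
    (hKV : ∀ z : ℤ, z.natAbs < K → pt z ∈ V) (n : ℕ) :
    ∀ (s : State 1) (y : ℤ), y.natAbs ≤ K → (y = 0 → 1 ≤ numActive (s.1 0)) →
      (y ≠ 0 → y.natAbs < K → 2 ≤ numActive (s.1 (pt y))) →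
      (∀ z : ℤ, z ≠ 0 → z.natAbs < K → Occ (s.1 (pt z))) →
      Bnd μ W s.2 {I | Ev (fun _ => 1) V Qe I s n} ((y.natAbs : ℝ≥0∞) / K + J) := by
  have hK0 : (K : ℝ≥0∞) ≠ 0 := by simp; omega
  induction n with
  | zero =>
    intro s y hy h0 h2 hocc
    by_cases hy0 : y = 0
    · exact (L.claimA h0V 0 s (h0 hy0)).mono subset_rfl le_add_self
    by_cases hyK : y.natAbs = K
    · refine Bnd.one L.hμ ?_
      rw [hyK, ENNReal.div_self hK0 (by simp)]
      exact le_self_add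
    have hlt : y.natAbs < K := by omega
    exact L.stepConst (fun _ => le_rfl) (hKV y hlt) (by have := h2 hy0 hlt; omega)
      (fun n' hn => by omega)
  | succ n ih =>
    intro s y hy h0 h2 hocc
    by_cases hy0 : y = 0
    · exact (L.claimA h0V _ s (h0 hy0)).mono subset_rfl le_add_self
    by_cases hyK : y.natAbs = K
    · refine Bnd.one L.hμ ?_
      rw [hyK, ENNReal.div_self hK0 (by simp)]
      exact le_self_add
    have hlt : y.natAbs < K := by omega
    have hy2 := h2 hy0 hlt
    have hJump : ∀ z : ℤ, (z = 1 ∨ z = -1) → 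
        Bnd μ W (toppleI V (some (pt z)) (pt y) s).2
          {I | Ev (fun _ => 1) V Qe I (toppleI V (some (pt z)) (pt y) s) n}
          (((y + z).natAbs : ℝ≥0∞) / K + J) := by
      intro z hz
      have hne : pt y + pt z ≠ pt y := by rw [pt_add, Ne, pt_inj]; omega
      refine ih _ (y + z) (by omega) ?_ ?_ ?_
      · intro h
        have hV : pt y + pt z ∈ V := by rw [pt_add, h]; exact h0V
        have := jump_target V (pt y) (pt z) s hV hne
        rw [pt_add, h, pt_zero] at this
        rw [this]
        have := numActive_add (s.1 0)
        omega
      · intro h hlt'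
        have hV : pt y + pt z ∈ V := by rw [pt_add]; exact hKV _ hlt'
        have := jump_target V (pt y) (pt z) s hV hne
        rw [pt_add] at this
        rw [this]
        exact (hocc _ h hlt').add_two
      · intro w hw0 hwK
        by_cases hwy : w = y
        · subst hwy
          exact Occ.of_active (numActive_self V _ _ s hy2)
        · exact Occ.topple_ne V _ _ _ s (by rwa [Ne, pt_inj]) (hocc w hw0 hwK)
    refine L.step (fun _ => le_rfl) (hKV y hlt) (by omega : 1 ≤ numActive (s.1 (pt y)))
      (fun i => match i with
        | none => (y.natAbs : ℝ≥0∞) / K + J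
        | some z => ((y + z 0).natAbs : ℝ≥0∞) / K + J) ?_ (le_of_eq ?_)
    · intro n' hn i hi
      obtain rfl : n' = n := by omega
      rcases hi with rfl | rfl | rfl
      · refine ih _ y hy (fun h => absurd h hy0) (fun _ _ => ?_) ?_
        · rw [sleep_two V _ s hy2]; exact hy2
        · intro w hw0 hwK
          by_cases hwy : w = y
          · subst hwy
            exact Occ.of_active (numActive_self V _ _ s hy2)
          · exact Occ.topple_ne V _ _ _ s (by rwa [Ne, pt_inj]) (hocc w hw0 hwK)
      · exact hJump 1 (Or.inl rfl)
      · exact hJump (-1) (Or.inr rfl)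
    · simp only [pt]
      have e : ((y + 1).natAbs : ℝ≥0∞) + ((y + -1).natAbs : ℝ≥0∞)
          = (y.natAbs : ℝ≥0∞) + (y.natAbs : ℝ≥0∞) := by
        have : (y + 1).natAbs + (y + -1).natAbs = y.natAbs + y.natAbs := by omega
        exact_mod_cast this
      have hpm := L.hpm
      have hJ := L.hJ
      have h1 := L.h1
      rw [← hpm] at hJ ⊢
      set b := W (some (pt 1))
      set k : ℝ≥0∞ := (y.natAbs : ℝ≥0∞)
      set c := (K : ℝ≥0∞)⁻¹
      simp only [div_eq_mul_inv]
      calc W none * (k * c + J) + b * (((y + 1).natAbs : ℝ≥0∞) * c + J)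
            + b * (((y + -1).natAbs : ℝ≥0∞) * c + J)
          = W none * (k * c + J) + b * ((((y + 1).natAbs : ℝ≥0∞)
            + ((y + -1).natAbs : ℝ≥0∞)) * c + (J + J)) := by ring
        _ = (W none + (b + b)) * (k * c + J) := by rw [e]; ring
        _ = k * c + J := by rw [hJ, h1, one_mul]

/-- Claim B. -/
theorem Law.claimB {μ : Measure (Stacks 1)} {W : Instr 1 → ℝ≥0∞} {J : ℝ≥0∞} (L : Law μ W J)
    {V : Finset (Site 1)} (h0V : (0 : Site 1) ∈ V) (K : ℕ) (hK : 1 ≤ K)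
    (hKV : ∀ z : ℤ, z.natAbs < K → pt z ∈ V) (n : ℕ) (s : State 1)
    (h0 : numActive (s.1 0) = 1) (hs : ∀ x ∈ V, x ≠ 0 → numActive (s.1 x) = 0)
    (hocc : ∀ z : ℤ, z ≠ 0 → z.natAbs < K → Occ (s.1 (pt z))) :
    Bnd μ W s.2 {I | Ev (fun _ => 1) V Qe I s n} (J * (1 / K + J)) := by
  refine L.stepTrial (fun _ => le_rfl) h0V h0.ge (trial_dead h0V h0 hs) ?_
  intro n' hn z hz
  have hz1 : z.natAbs = 1 := by omega
  have := L.claimW h0V K hK hKV n' (toppleI V (some (pt z)) 0 s) z (by omega)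
    (fun h => by omega) ?_ ?_
  · rw [hz1, Nat.cast_one] at this
    exact this
  · intro hz0 hlt
    have hV : 0 + pt z ∈ V := by rw [zero_add]; exact hKV _ hlt
    have hne : 0 + pt z ≠ 0 := by rw [← pt_zero, pt_add, Ne, pt_inj]; omega
    have := jump_target V 0 (pt z) s hV hne
    rw [zero_add] at this
    rw [this]
    exact (hocc z hz0 hlt).add_two
  · intro w hw hwK
    exact Occ.topple_ne V _ _ _ s (by rwa [← pt_zero, Ne, pt_inj]) (hocc w hw hwK)

/-- `K` is a radius without holes, `R` an extra condition; then the origin ends up empty. -/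
def Qh (V : Finset (Site 1)) (K : ℕ) (R : State 1 → Prop) (I : Stacks 1) (s : State 1) : Prop :=
  (∀ z : ℤ, z ≠ 0 → z.natAbs < K → Occ (s.1 (pt z))) ∧ R s ∧
    ∃ n, Ev (fun _ => 1) V Qe I s n

/-- Claim D. -/
theorem Law.claimD {μ : Measure (Stacks 1)} {W : Instr 1 → ℝ≥0∞} {J : ℝ≥0∞} (L : Law μ W J)
    {V : Finset (Site 1)} (h0V : (0 : Site 1) ∈ V) (K : ℕ) (hK : 1 ≤ K)
    (hKV : ∀ z : ℤ, z.natAbs < K → pt z ∈ V) (R : State 1 → Prop) (n : ℕ) :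
    ∀ s : State 1, 1 ≤ numActive (s.1 0) →
      Bnd μ W s.2 {I | Ev tw V (Qh V K R) I s n} (J * (1 / K + J)) := by
  have base : ∀ n (s : State 1), 1 ≤ numActive (s.1 0) →
      (¬ ∃ x ∈ V, tw x ≤ numActive (s.1 x)) →
      Bnd μ W s.2 {I | Ev tw V (Qh V K R) I s n} (J * (1 / K + J)) := by
    intro n s h0 hw
    push Not at hw
    by_cases hocc : ∀ z : ℤ, z ≠ 0 → z.natAbs < K → Occ (s.1 (pt z))
    · have h2 := hw 0 h0V
      simp only [tw, if_true] at h2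
      have hs : ∀ x ∈ V, x ≠ 0 → numActive (s.1 x) = 0 := by
        intro x hx hx0
        have := hw x hx
        simp only [tw, hx0, if_false] at this
        omega
      refine (Bnd.iUnion (E := fun k => {I | Ev (fun _ => 1) V Qe I s k}) ?_
        (fun k => L.claimB h0V K hK hKV k s (by omega) hs hocc)).mono ?_ le_rfl
      · intro a b hab I hI
        exact Ev.mono hab hI
      · intro I hI
        obtain ⟨k, hk⟩ := (Ev.stable hI hw).2.2
        exact Set.mem_iUnion.2 ⟨k, hk⟩
    · exact Bnd.empty fun I hI => hocc (Ev.stable hI hw).1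
  induction n with
  | zero =>
    intro s h0
    by_cases hw : ∃ x ∈ V, tw x ≤ numActive (s.1 x)
    · obtain ⟨x, hxV, hx⟩ := hw
      exact L.stepConst tw_pos hxV hx (fun n' hn => by omega)
    · exact base 0 s h0 hw
  | succ n ih =>
    intro s h0
    by_cases hw : ∃ x ∈ V, tw x ≤ numActive (s.1 x)
    · obtain ⟨x, hxV, hx⟩ := hw
      refine L.stepConst tw_pos hxV hx fun n' hn i => ?_
      obtain rfl : n' = n := by omega
      refine ih _ (weak_inv h0 ?_)
      rintro rfl
      simpa [tw] using hx
    · exact base _ s h0 hw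

/-- Claim C: a hole at `x`. -/
theorem Law.claimC {μ : Measure (Stacks 1)} {W : Instr 1 → ℝ≥0∞} {J : ℝ≥0∞} (L : Law μ W J)
    {V : Finset (Site 1)} (h0V : (0 : Site 1) ∈ V) (K : ℕ) (hK : 1 ≤ K)
    (hKV : ∀ z : ℤ, z.natAbs < K → pt z ∈ V) (x : Site 1) (hxV : x ∈ V) (hx0 : x ≠ 0) (n : ℕ) :
    ∀ s : State 1, 1 ≤ numActive (s.1 0) → 1 ≤ numActive (s.1 x) →
      Bnd μ W s.2 {I | Ev tw V (Qh V K (fun s => ¬ Occ (s.1 x))) I s n}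
        (J * (J * (1 / K + J))) := by
  have htx : tw x = 1 := by simp [tw, hx0]
  induction n with
  | zero =>
    intro s h0 hx
    exact L.stepConst tw_pos hxV (by omega) (fun n' hn => by omega)
  | succ n ih =>
    intro s h0 hx
    by_cases hw : ∃ y ∈ V, (if y = x then 2 else tw y) ≤ numActive (s.1 y)
    · obtain ⟨y, hyV, hy⟩ := hw
      have hy' : tw y ≤ numActive (s.1 y) := by
        by_cases h : y = x
        · subst h; simp only [if_true] at hy; omega
        · simpa only [h, if_false] using hy
      refine L.stepConst tw_pos hyV hy' fun n' hn i => ?_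
      obtain rfl : n' = n := by omega
      refine ih _ (weak_inv h0 ?_) (weak_inv hx ?_)
      · rintro rfl
        simpa [tw] using hy'
      · rintro rfl
        simpa using hy
    · push Not at hw
      have hx1 := hw x hxV
      simp only [if_true] at hx1
      refine L.stepTrial tw_pos hxV (by omega) ?_ ?_
      · intro n' I h
        have hsl := sleep_self V x s (by omega)
        refine (h.stable ?_).2.1 ?_
        · intro y hy
          by_cases h : y = x
          · subst h; rw [hsl]; exact tw_pos y
          · rw [sleep_ne V x y s h]
            simpa only [h, if_false] using hw y hy
        · rw [hsl]; simp [Occ]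
      · intro n' hn z hz
        exact L.claimD h0V K hK hKV _ n' _ (h0.trans (numActive_mono V _ x 0 s (Ne.symm hx0)))

/-- Existence of the weak stabilization when the stabilization terminates. -/
theorem weak_exists {V : Finset (Site 1)} {I : Stacks 1} (n : ℕ) :
    ∀ s : State 1, Ev (fun _ => 1) V Qe I s n →
      Ev tw V (fun I s => ∃ n, Ev (fun _ => 1) V Qe I s n) I s n := by
  induction n with
  | zero =>
    intro s h
    by_cases hw : ∃ x ∈ V, tw x ≤ numActive (s.1 x)
    · obtain ⟨x, hxV, hx⟩ := hw
      obtain ⟨n', h1, _⟩ := h.step (fun _ => le_rfl) hxV ((tw_pos x).trans hx)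
      omega
    · push Not at hw
      exact ⟨[], le_rfl, trivial, hw, 0, h⟩
  | succ n ih =>
    intro s h
    by_cases hw : ∃ x ∈ V, tw x ≤ numActive (s.1 x)
    · obtain ⟨x, hxV, hx⟩ := hw
      obtain ⟨n', h1, h2⟩ := h.step (fun _ => le_rfl) hxV ((tw_pos x).trans hx)
      obtain rfl : n = n' := by omega
      obtain ⟨l, g1, g2, g3⟩ := ih _ h2
      refine ⟨x :: l, by simpa using g1, ⟨hxV, hx, ?_⟩, ?_⟩
      · rw [topple_eq]; exact g2
      · simp only [run]; rw [topple_eq]; exact g3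
    · push Not at hw
      exact ⟨[], Nat.zero_le _, trivial, hw, n + 1, h⟩

theorem emptyAt0_ev {V : Finset (Site 1)} {I : Stacks 1} {η : Site 1 → ℕ}
    (h : EmptyAt0 V I η) : ∃ n, Ev (fun _ => 1) V Qe I (initState 1 V η) n := by
  obtain ⟨hc, h⟩ := h
  unfold stabConfig at h
  rw [dif_pos hc] at h
  obtain ⟨h1, h2⟩ := hc.choose_spec
  refine ⟨_, hc.choose, le_rfl, legal_g V I _ _ h1, fun x hx => ?_, h⟩
  rw [h2 x hx]; exact Nat.one_pos

theorem Bnd.measure {μ : Measure (Stacks 1)} {W : Instr 1 → ℝ≥0∞} {m : Site 1 → ℕ}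
    {E : Set (Stacks 1)} {p : ℝ≥0∞} (h : Bnd μ W m E p) : μ E ≤ p := by
  simpa using h ∅ (fun _ => none) (by simp)

/-- The decomposition over the nearest hole. -/
theorem Law.main {μ : Measure (Stacks 1)} {W : Instr 1 → ℝ≥0∞} {J : ℝ≥0∞} (L : Law μ W J)
    {V : Finset (Site 1)} (N : ℕ) (hV : ∀ z : ℤ, z.natAbs ≤ N → pt z ∈ V) (η : Site 1 → ℕ)
    (hη : ∀ z : ℤ, z.natAbs ≤ N → 1 ≤ η (pt z)) :
    μ {I | EmptyAt0 V I η} ≤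
      (∑ k ∈ Finset.range N, (J * (J * (1 / ((k + 1 : ℕ) : ℝ≥0∞) + J))
        + J * (J * (1 / ((k + 1 : ℕ) : ℝ≥0∞) + J))))
      + J * (1 / ((N + 1 : ℕ) : ℝ≥0∞) + J) := by
  set s0 := initState 1 V η
  have h0V : (0 : Site 1) ∈ V := hV 0 (by simp)
  have hact : ∀ z : ℤ, z.natAbs ≤ N → 1 ≤ numActive (s0.1 (pt z)) := by
    intro z hz
    simp only [s0, initState, numActive, hV z hz, if_true]
    exact hη z hz
  have hact0 : 1 ≤ numActive (s0.1 0) := hact 0 (by simp)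
  set S : ℤ → Set (Stacks 1) := fun z =>
    ⋃ n, {I | Ev tw V (Qh V z.natAbs (fun s => ¬ Occ (s.1 (pt z)))) I s0 n}
  set S' : Set (Stacks 1) := ⋃ n, {I | Ev tw V (Qh V (N + 1) (fun _ => True)) I s0 n}
  have hS : ∀ z : ℤ, 1 ≤ z.natAbs → z.natAbs ≤ N →
      μ (S z) ≤ J * (J * (1 / (z.natAbs : ℝ≥0∞) + J)) := by
    intro z h1 hN
    refine Bnd.measure (W := W) (m := s0.2) (Bnd.iUnion ?_ fun n => ?_)
    · intro a b hab I hI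
      exact Ev.mono hab hI
    · exact L.claimC h0V z.natAbs h1 (fun w hw => hV w (by omega)) (pt z) (hV z hN)
        (by rw [← pt_zero, Ne, pt_inj]; omega) n s0 hact0 (hact z hN)
  have hS' : μ S' ≤ J * (1 / ((N + 1 : ℕ) : ℝ≥0∞) + J) := by
    refine Bnd.measure (W := W) (m := s0.2) (Bnd.iUnion ?_ fun n => ?_)
    · intro a b hab I hI
      exact Ev.mono hab hI
    · exact L.claimD h0V (N + 1) (by omega) (fun w hw => hV w (by omega)) _ n s0 hact0
  have hsub : {I | EmptyAt0 V I η} ⊆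
      (⋃ k ∈ Finset.range N, (S ((k : ℤ) + 1) ∪ S (-((k : ℤ) + 1)))) ∪ S' := by
    classical
    intro I hI
    obtain ⟨n, hn⟩ := emptyAt0_ev hI
    obtain ⟨l, h1, h2, h3, h4⟩ := weak_exists n _ hn
    set s := run V I (initState 1 V η) l
    by_cases hh : ∃ k : ℕ, ∃ z : ℤ, z ≠ 0 ∧ z.natAbs = k ∧ k ≤ N ∧ ¬ Occ (s.1 (pt z))
    · obtain ⟨z, hz0, hzk, hkN, hzo⟩ := Nat.find_spec hh
      have hmin : ∀ w : ℤ, w ≠ 0 → w.natAbs < z.natAbs → Occ (s.1 (pt w)) := by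
        intro w hw0 hw
        by_contra hcon
        exact Nat.find_min hh (hzk ▸ hw) ⟨w, hw0, rfl, by omega, hcon⟩
      have hmem : I ∈ S z := Set.mem_iUnion.2 ⟨n, l, h1, h2, h3, hmin, hzo, h4⟩
      refine Or.inl ?_
      simp only [Set.mem_iUnion]
      refine ⟨z.natAbs - 1, Finset.mem_range.2 (by omega), ?_⟩
      rcases le_total 0 z with hz | hz
      · left
        have : ((z.natAbs - 1 : ℕ) : ℤ) + 1 = z := by omega
        rw [this]; exact hmem
      · right
        have : -(((z.natAbs - 1 : ℕ) : ℤ) + 1) = z := by omega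
        rw [this]; exact hmem
    · refine Or.inr (Set.mem_iUnion.2 ⟨n, l, h1, h2, h3, ?_, trivial, h4⟩)
      intro w hw0 hw
      by_contra hcon
      exact hh ⟨_, w, hw0, rfl, by omega, hcon⟩
  calc μ {I | EmptyAt0 V I η} ≤ _ := measure_mono hsub
    _ ≤ _ := measure_union_le _ _
    _ ≤ _ := by
      refine add_le_add ?_ hS'
      refine (measure_biUnion_finset_le _ _).trans (Finset.sum_le_sum fun k hk => ?_)
      have hkN := Finset.mem_range.1 hk
      refine (measure_union_le _ _).trans (add_le_add ?_ ?_)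
      · have := hS ((k : ℤ) + 1) (by omega) (by omega)
        rwa [show ((k : ℤ) + 1).natAbs = k + 1 by omega] at this
      · have := hS (-((k : ℤ) + 1)) (by omega) (by omega)
        rwa [show (-((k : ℤ) + 1)).natAbs = k + 1 by omega] at this

theorem law_of {lam : ℝ} (hl : 0 < lam) {μ : Measure (Stacks 1)}
    (h : IsStackLaw 1 (ssrwStep 1) lam μ) :
    Law μ (instrWeight (ssrwStep 1) lam) (ENNReal.ofReal (lamJ lam)) := by
  have hJ0 : 0 ≤ lamJ lam := by unfold lamJ; positivity
  have hS0 : 0 ≤ lamS lam := by unfold lamS; positivity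
  have e1 : ssrwStep 1 (pt 1) = 1 / 2 := by simp [ssrwStep, pt]
  have e2 : ssrwStep 1 (pt (-1)) = 1 / 2 := by simp [ssrwStep, pt]
  refine ⟨h.2, ?_, ?_, ?_, ?_⟩
  · intro i h1 h2 h3
    cases i with
    | none => exact absurd rfl h1
    | some z =>
      have : ssrwStep 1 z = 0 := by
        unfold ssrwStep
        rw [if_neg]
        intro hz
        simp only [Finset.univ_unique, Finset.sum_singleton] at hz
        have hz' : (z 0).natAbs = 1 := hz
        have : z 0 = 1 ∨ z 0 = -1 := by omega
        rcases this with h | h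
        · exact h2 (by rw [← pt_eta z, h])
        · exact h3 (by rw [← pt_eta z, h])
      simp [instrWeight, this]
  · simp only [instrWeight, e1, e2]
  · simp only [instrWeight, e1, e2]
    rw [← mul_add, ← ENNReal.ofReal_add (by norm_num) (by norm_num)]
    norm_num
  · simp only [instrWeight]
    rw [← ENNReal.ofReal_add hS0 hJ0, ← ENNReal.ofReal_one]
    congr 1
    unfold lamS lamJ
    have : 1 + lam ≠ 0 := by positivity
    field_simp
    ring

theorem real_bound {lam : ℝ} (hl : 3 ≤ lam) (j : ℝ) (hj0 : 0 ≤ j) (hj : j ≤ 1 / lam) :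
    (∑ k ∈ Finset.range ⌊lam⌋₊, (j * (j * (1 / ((k + 1 : ℕ) : ℝ) + j))
        + j * (j * (1 / ((k + 1 : ℕ) : ℝ) + j))))
      + j * (1 / ((⌊lam⌋₊ + 1 : ℕ) : ℝ) + j) ≤ 8 * (Real.log lam / lam ^ 2) := by
  have hl0 : 0 < lam := by linarith
  set N := ⌊lam⌋₊
  have hNle : (N : ℝ) ≤ lam := Nat.floor_le hl0.le
  have hNlt : lam < ((N + 1 : ℕ) : ℝ) := by push_cast; exact Nat.lt_floor_add_one lam
  have hharm : ∑ k ∈ Finset.range N, (1 / ((k + 1 : ℕ) : ℝ)) ≤ 1 + Real.log lam := by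
    have h1 := harmonic_le_one_add_log N
    have h2 : ((harmonic N : ℚ) : ℝ) = ∑ k ∈ Finset.range N, (1 / ((k + 1 : ℕ) : ℝ)) := by
      simp [harmonic]
    rw [← h2]
    refine h1.trans ?_
    have hN1 : (0 : ℝ) < N := by
      have : 1 ≤ N := Nat.le_floor (by norm_num; linarith)
      exact_mod_cast this
    have := Real.log_le_log hN1 hNle
    linarith
  have hlog : 1 ≤ Real.log lam := by
    rw [Real.le_log_iff_exp_le hl0]
    have := Real.exp_one_lt_d9
    linarith
  have e : (∑ k ∈ Finset.range N, (j * (j * (1 / ((k + 1 : ℕ) : ℝ) + j))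
        + j * (j * (1 / ((k + 1 : ℕ) : ℝ) + j))))
      = j ^ 2 * (2 * (∑ k ∈ Finset.range N, (1 / ((k + 1 : ℕ) : ℝ))) + 2 * (N * j)) := by
    have : ∀ k ∈ Finset.range N, (j * (j * (1 / ((k + 1 : ℕ) : ℝ) + j))
        + j * (j * (1 / ((k + 1 : ℕ) : ℝ) + j)))
        = (2 * j ^ 2) * (1 / ((k + 1 : ℕ) : ℝ)) + 2 * j ^ 3 := by
      intro k _; ring
    rw [Finset.sum_congr rfl this, Finset.sum_add_distrib, ← Finset.mul_sum]
    simp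
    ring
  have hNj : N * j ≤ 1 := by
    calc N * j ≤ lam * (1 / lam) := by gcongr
      _ = 1 := by field_simp
  have hj2 : j ^ 2 ≤ (1 / lam) ^ 2 := by gcongr
  have hlast : j * (1 / ((N + 1 : ℕ) : ℝ) + j) ≤ (1 / lam) ^ 2 * 2 := by
    have : 1 / ((N + 1 : ℕ) : ℝ) ≤ 1 / lam := one_div_le_one_div_of_le hl0 hNlt.le
    calc _ ≤ (1 / lam) * (1 / lam + 1 / lam) := by gcongr
      _ = _ := by ring
  rw [e]
  have hfirst : j ^ 2 * (2 * (∑ k ∈ Finset.range N, (1 / ((k + 1 : ℕ) : ℝ))) + 2 * (N * j))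
      ≤ (1 / lam) ^ 2 * (2 * (1 + Real.log lam) + 2 * 1) := by
    gcongr
  have hfin : (1 / lam) ^ 2 * (2 * (1 + Real.log lam) + 2 * 1) + (1 / lam) ^ 2 * 2
      ≤ (1 / lam) ^ 2 * (8 * Real.log lam) := by
    rw [← mul_add]
    gcongr
    linarith
  calc _ ≤ _ := add_le_add hfirst hlast
    _ ≤ _ := hfin
    _ = _ := by ring

end Pf
end ARW

open MeasureTheory ENNReal Filter Topology ARW

theorem arw_dim1_stab_empty_bound_base :
    ∃ C > (0 : ℝ), ∃ lam₀ > (1 : ℝ), ∀ lam ≥ lam₀,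
      ∀ V : Finset (Site 1), ball 1 lam ⊆ ↑V → ∀ η : Site 1 → ℕ, Fills η (ball 1 lam) →
        stackLaw 1 (ssrwStep 1) lam {I | EmptyAt0 V I η} ≤
          ENNReal.ofReal (C * (Real.log lam / lam ^ 2)) := by
  refine ⟨8, by norm_num, 3, by norm_num, fun lam hl V hV η hη => ?_⟩
  have hl0 : 0 < lam := by linarith
  unfold stackLaw
  split_ifs with h
  · have L := Pf.law_of hl0 h.choose_spec
    have hball : ∀ z : ℤ, z.natAbs ≤ ⌊lam⌋₊ → Pf.pt z ∈ ball 1 lam := by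
      intro z hz
      have : (z.natAbs : ℝ) ≤ lam := (Nat.le_floor_iff hl0.le).1 hz
      simpa [ball, Pf.pt] using this
    refine (L.main ⌊lam⌋₊ (fun z hz => hV (hball z hz)) η (fun z hz => hη _ (hball z hz))).trans ?_
    have hj0 : 0 ≤ lamJ lam := by unfold lamJ; positivity
    have hj : lamJ lam ≤ 1 / lam := by
      unfold lamJ
      exact one_div_le_one_div_of_le hl0 (by linarith)
    refine le_trans (le_of_eq ?_) (ENNReal.ofReal_le_ofReal
      (Pf.real_bound hl (lamJ lam) hj0 hj))
    have e0 : ∀ k : ℕ, ENNReal.ofReal (lamJ lam * (1 / ((k + 1 : ℕ) : ℝ) + lamJ lam))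
        = ENNReal.ofReal (lamJ lam) * (1 / ((k + 1 : ℕ) : ℝ≥0∞) + ENNReal.ofReal (lamJ lam)) := by
      intro k
      rw [ENNReal.ofReal_mul hj0, ENNReal.ofReal_add (by positivity) hj0,
        ENNReal.ofReal_div_of_pos (by positivity), ENNReal.ofReal_one, ENNReal.ofReal_natCast]
    rw [ENNReal.ofReal_add (Finset.sum_nonneg fun k _ => by positivity) (by positivity), e0,
      ENNReal.ofReal_sum_of_nonneg fun k _ => by positivity]
    congr 1
    refine Finset.sum_congr rfl fun k _ => ?_
    rw [ENNReal.ofReal_add (by positivity) (by positivity), ENNReal.ofReal_mul hj0, e0]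
  · simp
end
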